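/- arXiv:2405.16074 — 2 statements merged into one kernel-verified Lean document; each statement's English description precedes it below -/
import Mathlib

section
/- Existence of a smooth minimizer for the modified variational problem: for every ξ ≠ 0 and every s > 0, the functional W ↦ E(W;s,ξ) is bounded below on 𝒜_ξ, and its infimum Φ(s,ξ) is attained by a smooth function: there exists W₀ ∈ C^∞([0,1]) with W₀(0) = W₀(1) = 0 and J(W₀) = 1 such that E(W₀;s,ξ) = Φ(s,ξ). -/
open MeasureTheory Set

noncomputable section

/-- `E₀(W) = μ∫₀¹ (|D²W|² + 2ξ²|DW|² + ξ⁴W²) dx₂` -/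
def E0 (μ ξ : ℝ) (W : ℝ → ℝ) : ℝ :=
  μ * ∫ x in Icc (0 : ℝ) 1,
    ((deriv (deriv W) x) ^ 2 + 2 * ξ ^ 2 * (deriv W x) ^ 2 + ξ ^ 4 * (W x) ^ 2)

/-- `E₁(W) = −k₁(DW(1))² − k₀(DW(0))²` -/
def E1 (k0 k1 : ℝ) (W : ℝ → ℝ) : ℝ :=
  -k1 * (deriv W 1) ^ 2 - k0 * (deriv W 0) ^ 2

/-- `E₂(W) = gξ²∫₀¹ Dθ̄ W² dx₂` -/
def E2 (g ξ : ℝ) (θb : ℝ → ℝ) (W : ℝ → ℝ) : ℝ :=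
  g * ξ ^ 2 * ∫ x in Icc (0 : ℝ) 1, deriv θb x * (W x) ^ 2

/-- `E(W; s, ξ) = s·E₀(W) + s·E₁(W) + E₂(W)` -/
def Efun (μ g k0 k1 : ℝ) (θb : ℝ → ℝ) (s ξ : ℝ) (W : ℝ → ℝ) : ℝ :=
  s * E0 μ ξ W + s * E1 k0 k1 W + E2 g ξ θb W

/-- `J(W) = ∫₀¹ (|DW|² + ξ²W²) dx₂` -/
def Jfun (ξ : ℝ) (W : ℝ → ℝ) : ℝ :=
  ∫ x in Icc (0 : ℝ) 1, ((deriv W x) ^ 2 + ξ ^ 2 * (W x) ^ 2)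

/-- admissible set `𝒜_ξ = {W ∈ C²([0,1]) : W(0)=W(1)=0, J(W)=1}` -/
def Adm (ξ : ℝ) : Set (ℝ → ℝ) :=
  {W | ContDiff ℝ 2 W ∧ W 0 = 0 ∧ W 1 = 0 ∧ Jfun ξ W = 1}

/-- `Φ(s,ξ) = inf_{W ∈ 𝒜_ξ} E(W;s,ξ)` -/
def Phi (μ g k0 k1 : ℝ) (θb : ℝ → ℝ) (s ξ : ℝ) : ℝ :=
  sInf ((fun W => Efun μ g k0 k1 θb s ξ W) '' Adm ξ)


lemma glue_ode {E : Type*} [NormedAddCommGroup E] [NormedSpace ℝ E] (f : E → E) (Y α : ℝ → E)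
    (c : ℝ) (h : Y c = α c) (t : ℝ)
    (h1 : t ≤ c → HasDerivAt Y (f (Y t)) t) (h2 : c ≤ t → HasDerivAt α (f (α t)) t) :
    HasDerivAt (fun t => if t ≤ c then Y t else α t) (f (if t ≤ c then Y t else α t)) t := by
  rcases lt_trichotomy t c with hlt | rfl | hgt
  · rw [if_pos hlt.le]
    refine (h1 hlt.le).congr_of_eventuallyEq ?_
    filter_upwards [Iio_mem_nhds hlt] with x hx
    rw [if_pos (le_of_lt hx)]
  · rw [if_pos le_rfl]
    have a1 : HasDerivWithinAt (fun x => if x ≤ t then Y x else α x) (f (Y t)) (Iic t) t :=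
      (h1 le_rfl).hasDerivWithinAt.congr (fun x hx => if_pos hx) (if_pos le_rfl)
    have a2 : HasDerivWithinAt (fun x => if x ≤ t then Y x else α x) (f (Y t)) (Ici t) t := by
      have := (h2 le_rfl).hasDerivWithinAt (s := Ici t)
      rw [← h] at this
      refine this.congr (fun x hx => ?_) ?_
      · rcases eq_or_lt_of_le (show t ≤ x from hx) with rfl | h'
        · simp [h]
        · exact if_neg (not_le.2 h')
      · simp [h]
    have := a1.union a2
    rw [Iic_union_Ici] at this
    exact hasDerivWithinAt_univ.1 this
  · rw [if_neg (not_le.2 hgt)]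
    refine (h2 hgt.le).congr_of_eventuallyEq ?_
    filter_upwards [Ioi_mem_nhds hgt] with x hx
    rw [if_neg (not_le.2 hx)]

lemma extend_ode {E : Type*} [NormedAddCommGroup E] [NormedSpace ℝ E] [CompleteSpace E]
    (f : E → E) (hf : ContDiff ℝ (⊤ : ℕ∞) f) (Y : ℝ → E)
    (hY : ∀ t ∈ Icc (0 : ℝ) 1, HasDerivAt Y (f (Y t)) t) :
    ∃ ε > (0 : ℝ), ∃ Z : ℝ → E, EqOn Z Y (Icc 0 1) ∧
      ∀ t ∈ Ioo (-ε) (1 + ε), HasDerivAt Z (f (Z t)) t := by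
  have hf1 : ∀ x, ContDiffAt ℝ 1 f x := fun x => (hf.of_le (by exact_mod_cast le_top)).contDiffAt
  obtain ⟨α, hα, ε, hε, hα'⟩ :=
    (hf1 (Y 0)).exists_forall_mem_closedBall_exists_eq_forall_mem_Ioo_hasDerivAt₀ 0
  obtain ⟨β, hβ, δ, hδ, hβ'⟩ :=
    (hf1 (Y 1)).exists_forall_mem_closedBall_exists_eq_forall_mem_Ioo_hasDerivAt₀ 1
  refine ⟨min ε δ, lt_min hε hδ,
    fun t => if t ≤ 1 then (if t ≤ 0 then α t else Y t) else β t, ?_, ?_⟩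
  · intro t ht
    simp only [if_pos ht.2]
    split_ifs with h0
    · have : t = 0 := le_antisymm h0 ht.1
      rw [this, hα]
    · rfl
  · intro t ht
    have e1 := min_le_left ε δ
    have e2 := min_le_right ε δ
    refine glue_ode f (fun t => if t ≤ 0 then α t else Y t) β 1 ?_ t ?_ ?_
    · simp [hβ]
    · intro h1
      refine glue_ode f α Y 0 hα t ?_ ?_
      · intro h0
        exact hα' t ⟨by linarith [ht.1], by linarith⟩
      · intro h0
        exact hY t ⟨h0, h1⟩
    · intro h1
      exact hβ' t ⟨by linarith, by linarith [ht.2]⟩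

lemma smooth_ode {E : Type*} [NormedAddCommGroup E] [NormedSpace ℝ E]
    (f : E → E) (hf : ContDiff ℝ (⊤ : ℕ∞) f) (Z : ℝ → E) (s : Set ℝ) (hs : IsOpen s)
    (hZ : ∀ t ∈ s, HasDerivAt Z (f (Z t)) t) : ContDiffOn ℝ (⊤ : ℕ∞) Z s := by
  rw [contDiffOn_infty]
  intro n
  induction n with
  | zero =>
    simp only [Nat.cast_zero, contDiffOn_zero]
    exact fun t ht => (hZ t ht).continuousAt.continuousWithinAt
  | succ n ih =>
    push_cast
    rw [contDiffOn_succ_iff_deriv_of_isOpen hs]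
    refine ⟨fun t ht => (hZ t ht).differentiableAt.differentiableWithinAt, by simp, ?_⟩
    have : ContDiffOn ℝ n (fun t => f (Z t)) s :=
      (hf.of_le (by exact_mod_cast le_top)).comp_contDiffOn ih
    exact this.congr (fun t ht => (hZ t ht).deriv)

lemma cutoff_ext (ε : ℝ) (hε : 0 < ε) (z : ℝ → ℝ) (hz : ContDiffOn ℝ (⊤ : ℕ∞) z (Ioo (-ε) (1 + ε))) :
    ∃ w : ℝ → ℝ, ContDiff ℝ (⊤ : ℕ∞) w ∧ EqOn w z (Icc 0 1) := by
  let χ : ContDiffBump (1 / 2 : ℝ) := ⟨1 / 2 + ε / 3, 1 / 2 + 2 * ε / 3, by linarith, by linarith⟩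
  refine ⟨fun x => χ x * z x, ?_, ?_⟩
  · rw [contDiff_iff_contDiffAt]
    intro x
    by_cases hx : x ∈ Ioo (-ε) (1 + ε)
    · exact χ.contDiffAt.mul (hz.contDiffAt (isOpen_Ioo.mem_nhds hx))
    · have hx' : x ∉ tsupport χ := by
        rw [χ.tsupport_eq]
        intro h
        rw [Metric.mem_closedBall, Real.dist_eq, abs_le] at h
        simp only [χ] at h
        exact hx ⟨by linarith [h.1], by linarith [h.2]⟩
      have h0 : χ =ᶠ[nhds x] 0 := notMem_tsupport_iff_eventuallyEq.1 hx'
      refine (contDiffAt_const (c := (0 : ℝ))).congr_of_eventuallyEq ?_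
      filter_upwards [h0] with y hy
      simp [hy]
  · intro x hx
    have : χ x = 1 := by
      apply χ.one_of_mem_closedBall
      rw [Metric.mem_closedBall, Real.dist_eq, abs_le]
      simp only [χ]
      exact ⟨by linarith [hx.1], by linarith [hx.2]⟩
    simp [this]

def Dr (V : ℝ → ℝ) : Prop := ContDiff ℝ 2 V ∧ V 0 = 0 ∧ V 1 = 0

lemma c2_iff (V : ℝ → ℝ) : ContDiff ℝ 2 V ↔
    (Differentiable ℝ V ∧ Differentiable ℝ (deriv V) ∧ Continuous (deriv (deriv V))) := by
  rw [show (2 : WithTop ℕ∞) = 1 + 1 from rfl, contDiff_succ_iff_deriv, contDiff_one_iff_deriv]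
  simp

lemma Dr.d0 {V : ℝ → ℝ} (h : Dr V) (x : ℝ) : HasDerivAt V (deriv V x) x :=
  (((c2_iff V).1 h.1).1 x).hasDerivAt

lemma Dr.d1 {V : ℝ → ℝ} (h : Dr V) (x : ℝ) : HasDerivAt (deriv V) (deriv (deriv V) x) x :=
  (((c2_iff V).1 h.1).2.1 x).hasDerivAt

lemma Dr.c0 {V : ℝ → ℝ} (h : Dr V) : Continuous V := h.1.continuous
lemma Dr.c1 {V : ℝ → ℝ} (h : Dr V) : Continuous (deriv V) := ((c2_iff V).1 h.1).2.1.continuous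
lemma Dr.c2 {V : ℝ → ℝ} (h : Dr V) : Continuous (deriv (deriv V)) := ((c2_iff V).1 h.1).2.2

lemma exists_prim (r : ℝ → ℝ) (hr : Continuous r) : ∃ F : ℝ → ℝ, ∀ x, HasDerivAt F (r x) x :=
  ⟨fun x => ∫ t in (0 : ℝ)..x, r t, fun x =>
    intervalIntegral.integral_hasDerivAt_right (hr.intervalIntegrable _ _)
      (hr.stronglyMeasurableAtFilter _ _) hr.continuousAt⟩

lemma dr_of_hasDeriv (V V1 V2 : ℝ → ℝ) (h0 : V 0 = 0) (h1 : V 1 = 0)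
    (hV : ∀ x, HasDerivAt V (V1 x) x) (hV1 : ∀ x, HasDerivAt V1 (V2 x) x) (hc : Continuous V2) :
    Dr V ∧ deriv V = V1 ∧ deriv (deriv V) = V2 := by
  have e1 : deriv V = V1 := funext fun x => (hV x).deriv
  have e2 : deriv V1 = V2 := funext fun x => (hV1 x).deriv
  refine ⟨⟨(c2_iff V).2 ?_, h0, h1⟩, e1, by rw [e1, e2]⟩
  rw [e1, e2]
  exact ⟨fun x => (hV x).differentiableAt, fun x => (hV1 x).differentiableAt, hc⟩

lemma exists_dr (r : ℝ → ℝ) (hr : Continuous r) : ∃ V, Dr V ∧ deriv (deriv V) = r := by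
  obtain ⟨F, hF⟩ := exists_prim r hr
  have hFc : Continuous F := continuous_iff_continuousAt.2 fun x => (hF x).continuousAt
  obtain ⟨G, hG⟩ := exists_prim F hFc
  have := dr_of_hasDeriv (fun x => G x - G 0 - (G 1 - G 0) * x) (fun x => F x - (G 1 - G 0)) r
    (by simp) (by simp) (fun x => by
      have h := ((hG x).sub_const (G 0)).sub ((hasDerivAt_id x).const_mul (G 1 - G 0))
      rw [mul_one] at h
      exact h)
    (fun x => by simpa using (hF x).sub_const (G 1 - G 0)) hr
  exact ⟨_, this.1, this.2.2⟩

lemma Dr.comb {W V : ℝ → ℝ} (hW : Dr W) (hV : Dr V) (t : ℝ) :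
    Dr (fun x => W x + t * V x) ∧ deriv (fun x => W x + t * V x) = (fun x => deriv W x + t * deriv V x)
      ∧ deriv (deriv (fun x => W x + t * V x)) = fun x => deriv (deriv W) x + t * deriv (deriv V) x :=
  dr_of_hasDeriv _ _ _ (by simp [hW.2.1, hV.2.1]) (by simp [hW.2.2, hV.2.2])
    (fun x => (hW.d0 x).add ((hV.d0 x).const_mul t))
    (fun x => (hW.d1 x).add ((hV.d1 x).const_mul t))
    (hW.c2.add (hV.c2.const_mul t))

lemma Dr.smul {V : ℝ → ℝ} (hV : Dr V) (t : ℝ) :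
    Dr (fun x => t * V x) ∧ deriv (fun x => t * V x) = (fun x => t * deriv V x)
      ∧ deriv (deriv (fun x => t * V x)) = fun x => t * deriv (deriv V) x :=
  dr_of_hasDeriv _ _ _ (by simp [hV.2.1]) (by simp [hV.2.2])
    (fun x => ((hV.d0 x).const_mul t))
    (fun x => ((hV.d1 x).const_mul t))
    ((hV.c2.const_mul t))

lemma cs01 (f : ℝ → ℝ) (hf : Continuous f) : (∫ x in (0 : ℝ)..1, |f x|) ^ 2 ≤ ∫ x in (0 : ℝ)..1, f x ^ 2 := by
  set A := ∫ x in (0 : ℝ)..1, |f x| with hA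
  have h : 0 ≤ ∫ x in (0 : ℝ)..1, (|f x| - A) ^ 2 :=
    intervalIntegral.integral_nonneg (by norm_num) fun x _ => sq_nonneg _
  have e : ∫ x in (0 : ℝ)..1, (|f x| - A) ^ 2 = (∫ x in (0 : ℝ)..1, f x ^ 2) - 2 * A * A + A ^ 2 := by
    have : ∀ x, (|f x| - A) ^ 2 = f x ^ 2 - 2 * A * |f x| + A ^ 2 := fun x => by
      rw [sub_sq, sq_abs]; ring
    simp_rw [this]
    rw [intervalIntegral.integral_add, intervalIntegral.integral_sub, intervalIntegral.integral_const_mul]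
    · simp [← hA]
    all_goals apply Continuous.intervalIntegrable; fun_prop
  rw [e] at h
  nlinarith

lemma abs_int_le (f : ℝ → ℝ) (hf : Continuous f) (c x : ℝ) (hc : c ∈ Icc (0 : ℝ) 1) (hx : x ∈ Icc (0 : ℝ) 1) :
    |∫ t in c..x, f t| ≤ ∫ t in (0 : ℝ)..1, |f t| := by
  have h0 := intervalIntegral.norm_integral_le_integral_norm_uIoc (f := f) (a := c) (b := x) (μ := volume)
  refine h0.trans ?_
  rw [intervalIntegral.integral_of_le (by norm_num : (0 : ℝ) ≤ 1)]
  refine setIntegral_mono_set ?_ (Filter.Eventually.of_forall fun x => abs_nonneg _) ?_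
  · exact (hf.abs.integrableOn_Icc (a := 0) (b := 1)).mono_set Ioc_subset_Icc_self
  · refine (LE.le.eventuallyLE ?_)
    intro y hy
    rw [uIoc, mem_Ioc] at hy
    exact ⟨lt_of_le_of_lt (le_min hc.1 hx.1) hy.1, hy.2.trans (max_le hc.2 hx.2)⟩

lemma poincare {V : ℝ → ℝ} (hV : Dr V) (x : ℝ) (hx : x ∈ Icc (0 : ℝ) 1) :
    deriv V x ^ 2 ≤ (∫ t in (0 : ℝ)..1, deriv (deriv V) t ^ 2) ∧
    V x ^ 2 ≤ ∫ t in (0 : ℝ)..1, deriv (deriv V) t ^ 2 := by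
  obtain ⟨c, hc, hc0⟩ := exists_deriv_eq_zero (f := V) (by norm_num : (0 : ℝ) < 1)
    hV.c0.continuousOn (by rw [hV.2.1, hV.2.2])
  have hcs := cs01 _ hV.c2
  set A := ∫ t in (0 : ℝ)..1, |deriv (deriv V) t| with hA
  have k1 : ∀ y ∈ Icc (0 : ℝ) 1, |deriv V y| ≤ A := by
    intro y hy
    have := abs_int_le _ hV.c2 c y (Ioo_subset_Icc_self hc) hy
    rw [intervalIntegral.integral_eq_sub_of_hasDerivAt (fun z _ => hV.d1 z)
      (hV.c2.intervalIntegrable _ _), hc0, sub_zero] at this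
    exact this
  have hA0 : 0 ≤ A := (abs_nonneg _).trans (k1 x hx)
  have k0 : |V x| ≤ A := by
    have := abs_int_le _ hV.c1 0 x (by simp) hx
    rw [intervalIntegral.integral_eq_sub_of_hasDerivAt (fun z _ => hV.d0 z)
      (hV.c1.intervalIntegrable _ _), hV.2.1, sub_zero] at this
    refine this.trans ?_
    calc (∫ t in (0 : ℝ)..1, |deriv V t|) ≤ ∫ t in (0 : ℝ)..1, A :=
          intervalIntegral.integral_mono_on (by norm_num) (hV.c1.abs.intervalIntegrable _ _)
            (by simp) k1
      _ = A := by simp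
  exact ⟨(sq_le_sq' (abs_le.1 (k1 x hx)).1 (abs_le.1 (k1 x hx)).2).trans hcs,
    (sq_le_sq' (abs_le.1 k0).1 (abs_le.1 k0).2).trans hcs⟩

def Qf (m a : ℝ) (b : ℝ → ℝ) (c0 c1 : ℝ) (W : ℝ → ℝ) : ℝ :=
  (∫ x in (0 : ℝ)..1, (m * deriv (deriv W) x ^ 2 + a * deriv W x ^ 2 + b x * W x ^ 2))
    + c1 * deriv W 1 ^ 2 + c0 * deriv W 0 ^ 2

def Pf (a c0 c1 : ℝ) (R W : ℝ → ℝ) (d0 d1 : ℝ) (x : ℝ) : ℝ :=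
  -a * W x + R x + (-c0 * d0 * (1 - x) + c1 * d1 * x)

lemma cross (a c0 c1 : ℝ) (b : ℝ → ℝ) (hb : Continuous b) (W V R : ℝ → ℝ)
    (hW : Dr W) (hV : Dr V) (hR : Dr R)
    (hRb : ∀ x ∈ Icc (0 : ℝ) 1, deriv (deriv R) x = b x * W x) :
    (∫ x in (0 : ℝ)..1, (a * (deriv W x * deriv V x) + b x * (W x * V x)))
      + c1 * (deriv W 1 * deriv V 1) + c0 * (deriv W 0 * deriv V 0)
    = ∫ x in (0 : ℝ)..1, Pf a c0 c1 R W (deriv W 0) (deriv W 1) x * deriv (deriv V) x := by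
  have := hW.c0; have := hW.c1; have := hW.c2; have := hV.c0; have := hV.c1; have := hV.c2
  have := hR.c0; have := hR.c1; have := hR.c2
  set p := -c0 * deriv W 0 with hp
  set q := c1 * deriv W 1 with hq
  have key : ∫ x in (0 : ℝ)..1, (a * (deriv W x * deriv V x) + deriv (deriv R) x * V x
      - (-a * W x + R x + (p * (1 - x) + q * x)) * deriv (deriv V) x)
      = -q * deriv V 1 + p * deriv V 0 := by
    rw [intervalIntegral.integral_eq_sub_of_hasDerivAt (f := fun x =>
      a * (W x * deriv V x) + deriv R x * V x - R x * deriv V x - (p * (1 - x) + q * x) * deriv V x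
       + (q - p) * V x)]
    · simp only [hW.2.1, hW.2.2, hV.2.1, hV.2.2, hR.2.1, hR.2.2]; ring
    · intro x _
      have hl : HasDerivAt (fun x : ℝ => p * (1 - x) + q * x) (p * (-1) + q * 1) x :=
        (((hasDerivAt_id x).const_sub 1).const_mul p).add ((hasDerivAt_id x).const_mul q)
      have h := ((((((hW.d0 x).mul (hV.d1 x)).const_mul a).add ((hR.d1 x).mul (hV.d0 x))).sub
        ((hR.d0 x).mul (hV.d1 x))).sub (hl.mul (hV.d1 x))).add ((hV.d0 x).const_mul (q - p))
      refine h.congr_deriv ?_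
      ring
    · apply Continuous.intervalIntegrable; fun_prop
  rw [intervalIntegral.integral_sub] at key
  · have e : ∫ x in (0 : ℝ)..1, (a * (deriv W x * deriv V x) + b x * (W x * V x)) =
      ∫ x in (0 : ℝ)..1, (a * (deriv W x * deriv V x) + deriv (deriv R) x * V x) := by
      refine intervalIntegral.integral_congr fun x hx => ?_
      rw [uIcc_of_le (by norm_num)] at hx
      simp only [hRb x hx]; ring
    rw [e]
    simp only [Pf, ← hp, ← hq]
    rw [sub_eq_iff_eq_add] at key
    rw [key, hp, hq]; ring
  all_goals apply Continuous.intervalIntegrable; fun_prop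

lemma Qf_expand (m a c0 c1 : ℝ) (b : ℝ → ℝ) (hb : Continuous b) (W V R : ℝ → ℝ)
    (hW : Dr W) (hV : Dr V) (hR : Dr R)
    (hRb : ∀ x ∈ Icc (0 : ℝ) 1, deriv (deriv R) x = b x * W x) (t : ℝ) :
    Qf m a b c0 c1 (fun x => W x + t * V x) = Qf m a b c0 c1 W
      + 2 * t * (∫ x in (0 : ℝ)..1, (m * deriv (deriv W) x + Pf a c0 c1 R W (deriv W 0) (deriv W 1) x)
          * deriv (deriv V) x) + t ^ 2 * Qf m a b c0 c1 V := by
  have := hW.c0; have := hW.c1; have := hW.c2; have := hV.c0; have := hV.c1; have := hV.c2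
  have := hR.c0; have := hR.c1; have := hR.c2
  have hP : Continuous (Pf a c0 c1 R W (deriv W 0) (deriv W 1)) := by unfold Pf; fun_prop
  have hc := cross a c0 c1 b hb W V R hW hV hR hRb
  unfold Qf
  rw [(hW.comb hV t).2.2, (hW.comb hV t).2.1]
  have e1 : ∫ x in (0 : ℝ)..1, (m * deriv (deriv W) x + Pf a c0 c1 R W (deriv W 0) (deriv W 1) x)
          * deriv (deriv V) x = (∫ x in (0 : ℝ)..1, m * (deriv (deriv W) x * deriv (deriv V) x)) +
       ∫ x in (0 : ℝ)..1, Pf a c0 c1 R W (deriv W 0) (deriv W 1) x * deriv (deriv V) x := by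
    rw [← intervalIntegral.integral_add]
    · refine intervalIntegral.integral_congr fun x _ => ?_
      ring
    all_goals apply Continuous.intervalIntegrable; fun_prop
  have e2 : ∫ x in (0 : ℝ)..1, (m * (deriv (deriv W) x + t * deriv (deriv V) x) ^ 2
      + a * (deriv W x + t * deriv V x) ^ 2 + b x * (W x + t * V x) ^ 2)
      = (∫ x in (0 : ℝ)..1, (m * deriv (deriv W) x ^ 2 + a * deriv W x ^ 2 + b x * W x ^ 2))
       + (2 * t * ((∫ x in (0 : ℝ)..1, m * (deriv (deriv W) x * deriv (deriv V) x)) +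
         (∫ x in (0 : ℝ)..1, (a * (deriv W x * deriv V x) + b x * (W x * V x)))) 
       + t ^ 2 * ∫ x in (0 : ℝ)..1, (m * deriv (deriv V) x ^ 2 + a * deriv V x ^ 2 + b x * V x ^ 2)) := by
    rw [← intervalIntegral.integral_add, ← intervalIntegral.integral_const_mul,
      ← intervalIntegral.integral_const_mul, ← intervalIntegral.integral_add,
      ← intervalIntegral.integral_add]
    · refine intervalIntegral.integral_congr fun x _ => ?_
      ring
    all_goals apply Continuous.intervalIntegrable; fun_prop
  rw [e1, e2, ← hc]
  ring

lemma Qf_le (m a c0 c1 B : ℝ) (hm : 0 < m) (b : ℝ → ℝ) (hb : Continuous b)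
    (hB : ∀ x ∈ Icc (0 : ℝ) 1, |b x| ≤ B) (V : ℝ → ℝ) (hV : Dr V) :
    Qf m a b c0 c1 V ≤ (m + |a| + B + |c1| + |c0|) * ∫ x in (0 : ℝ)..1, deriv (deriv V) x ^ 2 := by
  have := hV.c0; have := hV.c1; have := hV.c2
  set S := ∫ x in (0 : ℝ)..1, deriv (deriv V) x ^ 2 with hS
  have p := poincare hV
  have aux : ∀ c z D : ℝ, z ^ 2 ≤ S → |c| ≤ D → c * z ^ 2 ≤ D * S := by
    intro c z D hz hcD
    calc c * z ^ 2 ≤ |c| * z ^ 2 := mul_le_mul_of_nonneg_right (le_abs_self c) (sq_nonneg z)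
      _ ≤ D * S := mul_le_mul hcD hz (sq_nonneg z) ((abs_nonneg c).trans hcD)
  have i1 : ∫ x in (0 : ℝ)..1, (m * deriv (deriv V) x ^ 2 + a * deriv V x ^ 2 + b x * V x ^ 2)
      ≤ ∫ x in (0 : ℝ)..1, (m * deriv (deriv V) x ^ 2 + (|a| * S + B * S)) := by
    refine intervalIntegral.integral_mono_on (by norm_num) ?_ ?_ ?_
    · apply Continuous.intervalIntegrable; fun_prop
    · apply Continuous.intervalIntegrable; fun_prop
    · intro x hx
      have h1 := aux a _ _ (p x hx).1 le_rfl
      have h2 := aux (b x) _ _ (p x hx).2 (hB x hx)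
      linarith
  have i2 : ∫ x in (0 : ℝ)..1, (m * deriv (deriv V) x ^ 2 + (|a| * S + B * S))
      = m * S + (|a| * S + B * S) := by
    rw [intervalIntegral.integral_add, intervalIntegral.integral_const_mul, ← hS]
    · simp
    all_goals apply Continuous.intervalIntegrable; fun_prop
  · have h1 := aux c1 _ _ (p 1 (by simp)).1 le_rfl
    have h0 := aux c0 _ _ (p 0 (by simp)).1 le_rfl
    unfold Qf
    linarith

/-- residual bound -/
lemma resid (m a c0 c1 B : ℝ) (hm : 0 < m) (b : ℝ → ℝ) (hb : Continuous b)
    (hB : ∀ x ∈ Icc (0 : ℝ) 1, |b x| ≤ B)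
    (hQ : ∀ V, Dr V → 0 ≤ Qf m a b c0 c1 V) (W R : ℝ → ℝ) (hW : Dr W) (hR : Dr R)
    (hRb : ∀ x ∈ Icc (0 : ℝ) 1, deriv (deriv R) x = b x * W x) :
    ∫ x in (0 : ℝ)..1, (m * deriv (deriv W) x + Pf a c0 c1 R W (deriv W 0) (deriv W 1) x) ^ 2
      ≤ (m + |a| + B + |c1| + |c0|) * Qf m a b c0 c1 W := by
  have := hW.c0; have := hW.c1; have := hW.c2
  have := hR.c0; have := hR.c1; have := hR.c2
  have hP : Continuous (Pf a c0 c1 R W (deriv W 0) (deriv W 1)) := by unfold Pf; fun_prop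
  obtain ⟨V, hV, hVr⟩ := exists_dr (fun x => m * deriv (deriv W) x
    + Pf a c0 c1 R W (deriv W 0) (deriv W 1) x) (by fun_prop)
  have hB0 : 0 ≤ B := (abs_nonneg _).trans (hB 0 (by simp))
  set C := m + |a| + B + |c1| + |c0| with hC
  have hCpos : 0 < C := by positivity
  have h1 := hQ _ (hW.comb hV (-1 / C)).1
  rw [Qf_expand m a c0 c1 b hb W V R hW hV hR hRb, hVr] at h1
  have h2 := Qf_le m a c0 c1 B hm b hb hB V hV
  rw [hVr, ← hC] at h2
  simp only [← pow_two] at h1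
  set ρ := ∫ x in (0 : ℝ)..1, (m * deriv (deriv W) x
    + Pf a c0 c1 R W (deriv W 0) (deriv W 1) x) ^ 2 with hρ
  have h3 : (-1 / C) ^ 2 * Qf m a b c0 c1 V ≤ (-1 / C) ^ 2 * (C * ρ) :=
    mul_le_mul_of_nonneg_left h2 (sq_nonneg _)
  have h4 : 0 ≤ Qf m a b c0 c1 W - ρ / C := by
    have : (-1 / C) ^ 2 * (C * ρ) = ρ / C := by field_simp
    have : 2 * (-1 / C) * ρ = - 2 * (ρ / C) := by field_simp
    linarith
  have h5 : ρ / C ≤ Qf m a b c0 c1 W := by linarith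
  rw [div_le_iff₀ hCpos] at h5
  linarith

lemma Qf_zero (m a c0 c1 : ℝ) (b : ℝ → ℝ) (hb : Continuous b) (W R : ℝ → ℝ)
    (hW : Dr W) (hR : Dr R)
    (hRb : ∀ x ∈ Icc (0 : ℝ) 1, deriv (deriv R) x = b x * W x)
    (hE : ∀ x ∈ Icc (0 : ℝ) 1, m * deriv (deriv W) x + Pf a c0 c1 R W (deriv W 0) (deriv W 1) x = 0) :
    Qf m a b c0 c1 W = 0 := by
  have h := Qf_expand m a c0 c1 b hb W W R hW hW hR hRb (-1)
  have e0 : (fun x => W x + -1 * W x) = fun _ => (0 : ℝ) := by funext x; ring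
  have ez : ∫ x in (0 : ℝ)..1, (m * deriv (deriv W) x + Pf a c0 c1 R W (deriv W 0) (deriv W 1) x)
          * deriv (deriv W) x = 0 := by
    rw [intervalIntegral.integral_congr (g := fun _ => (0 : ℝ))]
    · simp
    · intro x hx
      rw [uIcc_of_le (by norm_num)] at hx
      simp [hE x hx]
  rw [e0, ez] at h
  have : Qf m a b c0 c1 (fun _ => (0 : ℝ)) = 0 := by simp [Qf]
  linarith

lemma compact_seq (W : ℕ → ℝ → ℝ) (hW : ∀ n, Dr (W n)) (M : ℝ) (hM : 0 ≤ M)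
    (hb : ∀ n, ∫ x in (0 : ℝ)..1, deriv (deriv (W n)) x ^ 2 ≤ M ^ 2) :
    ∃ φ : ℕ → ℕ, StrictMono φ ∧ ∃ (w : ℝ → ℝ) (d0 d1 : ℝ) (δ : ℕ → ℝ), Continuous w ∧
      Filter.Tendsto δ Filter.atTop (nhds 0) ∧
      (∀ n, ∀ x ∈ Icc (0 : ℝ) 1, |W (φ n) x - w x| ≤ δ n) ∧
      Filter.Tendsto (fun n => deriv (W (φ n)) 0) Filter.atTop (nhds d0) ∧
      Filter.Tendsto (fun n => deriv (W (φ n)) 1) Filter.atTop (nhds d1) := by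
  have p0 : ∀ n, ∀ x ∈ Icc (0 : ℝ) 1, |W n x| ≤ M := fun n x hx =>
    abs_le_of_sq_le_sq (((poincare (hW n) x hx).2).trans (hb n)) hM
  have p1 : ∀ n, ∀ x ∈ Icc (0 : ℝ) 1, |deriv (W n) x| ≤ M := fun n x hx =>
    abs_le_of_sq_le_sq (((poincare (hW n) x hx).1).trans (hb n)) hM
  let F : ℕ → BoundedContinuousFunction (Icc (0 : ℝ) 1) ℝ := fun n =>
    BoundedContinuousFunction.mkOfCompact ⟨fun x => W n x, (hW n).c0.comp continuous_subtype_val⟩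
  have hlip : ∀ n, LipschitzWith ⟨M, hM⟩ (fun x : Icc (0 : ℝ) 1 => W n x) := by
    intro n
    have : LipschitzOnWith ⟨M, hM⟩ (W n) (Icc 0 1) := by
      apply Convex.lipschitzOnWith_of_nnnorm_deriv_le
      · exact fun x _ => ((hW n).d0 x).differentiableAt
      · intro x hx
        exact p1 n x hx
      · exact convex_Icc 0 1
    exact lipschitzOnWith_iff_restrict.1 this
  have hcpt : IsCompact (closure (range F)) := by
    refine BoundedContinuousFunction.arzela_ascoli (Icc (-M) M) isCompact_Icc _ ?_ ?_
    · rintro f x ⟨n, rfl⟩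
      exact abs_le.1 (p0 n x x.2)
    · refine (LipschitzWith.uniformEquicontinuous _ ⟨M, hM⟩ ?_).equicontinuous
      rintro ⟨f, n, rfl⟩
      exact hlip n
  have hc3 := hcpt.prod ((isCompact_Icc (a := -M) (b := M)).prod (isCompact_Icc (a := -M) (b := M)))
  obtain ⟨⟨f, d0, d1⟩, -, φ, hφ, hlim⟩ := hc3.tendsto_subseq
    (x := fun n => (F n, deriv (W n) 0, deriv (W n) 1))
    (fun n => ⟨subset_closure ⟨n, rfl⟩, abs_le.1 (p1 n 0 (by simp)), abs_le.1 (p1 n 1 (by simp))⟩)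
  rw [nhds_prod_eq, nhds_prod_eq, Filter.tendsto_prod_iff', Filter.tendsto_prod_iff'] at hlim
  refine ⟨φ, hφ, IccExtend (zero_le_one) f, d0, d1, fun n => dist (F (φ n)) f, ?_, ?_, ?_, ?_, ?_⟩
  · exact f.continuous.Icc_extend'
  · exact tendsto_iff_dist_tendsto_zero.1 hlim.1
  · intro n x hx
    rw [IccExtend_of_mem _ _ hx]
    exact BoundedContinuousFunction.dist_coe_le_dist (f := F (φ n)) (g := f) ⟨x, hx⟩
  · exact hlim.2.1
  · exact hlim.2.2

lemma int_sq_le (f : ℝ → ℝ) (hf : Continuous f) (η : ℝ) (h : ∀ x ∈ Icc (0 : ℝ) 1, |f x| ≤ η) :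
    ∫ x in (0 : ℝ)..1, f x ^ 2 ≤ η ^ 2 := by
  calc ∫ x in (0 : ℝ)..1, f x ^ 2 ≤ ∫ x in (0 : ℝ)..1, η ^ 2 := by
        refine intervalIntegral.integral_mono_on (by norm_num) ?_ (by simp) ?_
        · apply Continuous.intervalIntegrable; fun_prop
        · intro x hx
          exact sq_le_sq' (abs_le.1 (h x hx)).1 (abs_le.1 (h x hx)).2
    _ = η ^ 2 := by simp

lemma limit_exists (m a c0 c1 : ℝ) (hm : 0 < m) (b : ℝ → ℝ) (hb : Continuous b)
    (hQ : ∀ V, Dr V → 0 ≤ Qf m a b c0 c1 V) (W : ℕ → ℝ → ℝ) (hW : ∀ n, Dr (W n)) (M : ℝ) (hM : 0 ≤ M)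
    (hbd : ∀ n, ∫ x in (0 : ℝ)..1, deriv (deriv (W n)) x ^ 2 ≤ M ^ 2)
    (hlim : Filter.Tendsto (fun n => Qf m a b c0 c1 (W n)) Filter.atTop (nhds 0)) :
    ∃ φ : ℕ → ℕ, StrictMono φ ∧ ∃ w R : ℝ → ℝ, Dr w ∧ Dr R ∧
      (∀ x ∈ Icc (0 : ℝ) 1, deriv (deriv R) x = b x * w x) ∧
      (∀ x ∈ Icc (0 : ℝ) 1, m * deriv (deriv w) x + Pf a c0 c1 R w (deriv w 0) (deriv w 1) x = 0) ∧
      Filter.Tendsto (fun n => ∫ x in (0 : ℝ)..1, (deriv (deriv (W (φ n))) x - deriv (deriv w) x) ^ 2)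
        Filter.atTop (nhds 0) := by
  obtain ⟨φ, hφ, w, d0, d1, δ, hwc, hδ, hwδ, hd0, hd1⟩ := compact_seq W hW M hM hbd
  obtain ⟨B, hB⟩ := isCompact_Icc.exists_bound_of_continuousOn (hb.continuousOn (s := Icc (0 : ℝ) 1))
  simp only [Real.norm_eq_abs] at hB
  have hB0 : 0 ≤ B := (abs_nonneg _).trans (hB 0 (by simp))
  obtain ⟨R, hR, hRb⟩ := exists_dr (fun x => b x * w x) (by fun_prop)
  have hRn : ∀ n, ∃ S, Dr S ∧ deriv (deriv S) = fun x => b x * W (φ n) x := fun n =>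
    exists_dr _ (hb.mul (hW (φ n)).c0)
  choose S hS hSb using hRn
  have hPc : Continuous (Pf a c0 c1 R w d0 d1) := by
    have := hR.c0
    unfold Pf; fun_prop
  have hδ0 : ∀ n, 0 ≤ δ n := fun n => (abs_nonneg _).trans (hwδ n 0 (by simp))
  have hSR : ∀ n, ∀ x ∈ Icc (0 : ℝ) 1, |S n x - R x| ≤ B * δ n := by
    intro n x hx
    have hc := (hS n).comb hR (-1)
    have h1 := (poincare hc.1 x hx).2
    rw [hc.2.2, hSb, hRb] at h1
    have := (hW (φ n)).c0
    have h2 := int_sq_le (fun x => b x * W (φ n) x + -1 * (b x * w x)) (by fun_prop) (B * δ n) (by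
      intro y hy
      rw [show b y * W (φ n) y + -1 * (b y * w y) = b y * (W (φ n) y - w y) by ring, abs_mul]
      exact mul_le_mul (hB y hy) (hwδ n y hy) (abs_nonneg _) hB0)
    have h3 := abs_le_of_sq_le_sq (h1.trans h2) (mul_nonneg hB0 (hδ0 n))
    rwa [show S n x + -1 * R x = S n x - R x by ring] at h3
  let η : ℕ → ℝ := fun n => |a| * δ n + B * δ n + |c0| * |deriv (W (φ n)) 0 - d0|
    + |c1| * |deriv (W (φ n)) 1 - d1|
  have hη : Filter.Tendsto η Filter.atTop (nhds 0) := by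
    have e0 : Filter.Tendsto (fun n => |deriv (W (φ n)) 0 - d0|) Filter.atTop (nhds 0) := by
      simpa using (hd0.sub_const d0).abs
    have e1 : Filter.Tendsto (fun n => |deriv (W (φ n)) 1 - d1|) Filter.atTop (nhds 0) := by
      simpa using (hd1.sub_const d1).abs
    have := (((hδ.const_mul |a|).add (hδ.const_mul B)).add (e0.const_mul |c0|)).add (e1.const_mul |c1|)
    simpa using this
  let Pn : ℕ → ℝ → ℝ := fun n => Pf a c0 c1 (S n) (W (φ n)) (deriv (W (φ n)) 0) (deriv (W (φ n)) 1)
  have hPnc : ∀ n, Continuous (Pn n) := by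
    intro n
    have := (hS n).c0
    have := (hW (φ n)).c0
    simp only [Pn]
    unfold Pf; fun_prop
  have hPP : ∀ n, ∀ x ∈ Icc (0 : ℝ) 1, |Pn n x - Pf a c0 c1 R w d0 d1 x| ≤ η n := by
    intro n x hx
    have e : Pn n x - Pf a c0 c1 R w d0 d1 x = (-a) * (W (φ n) x - w x) + (S n x - R x)
      + (-c0 * (deriv (W (φ n)) 0 - d0)) * (1 - x) + (c1 * (deriv (W (φ n)) 1 - d1)) * x := by
      simp only [Pn, Pf]; ring
    rw [e]
    refine (abs_add_le _ _).trans (add_le_add ((abs_add_le _ _).trans (add_le_add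
      ((abs_add_le _ _).trans (add_le_add ?_ (hSR n x hx))) ?_)) ?_)
    · rw [abs_mul, abs_neg]
      exact mul_le_mul_of_nonneg_left (hwδ n x hx) (abs_nonneg _)
    · rw [abs_mul, abs_mul, abs_neg]
      refine mul_le_of_le_one_right (by positivity) ?_
      rw [abs_le]; constructor <;> linarith [hx.1, hx.2]
    · rw [abs_mul, abs_mul]
      refine mul_le_of_le_one_right (by positivity) ?_
      rw [abs_le]; constructor <;> linarith [hx.1, hx.2]
  obtain ⟨u, hu, hur⟩ := exists_dr (fun x => -(Pf a c0 c1 R w d0 d1 x) / m) (by fun_prop)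
  let C := m + |a| + B + |c1| + |c0|
  have hI : ∀ n, ∫ x in (0 : ℝ)..1, (deriv (deriv (W (φ n))) x - deriv (deriv u) x) ^ 2
      ≤ (2 / m ^ 2) * (C * Qf m a b c0 c1 (W (φ n)) + η n ^ 2) := by
    intro n
    have h1 := resid m a c0 c1 B hm b hb hB hQ (W (φ n)) (S n) (hW _) (hS n) (fun x _ => by rw [hSb])
    have h2 := int_sq_le (fun x => Pn n x - Pf a c0 c1 R w d0 d1 x) ((hPnc n).sub hPc) _ (hPP n)
    have hWc := (hW (φ n)).c2
    have huc := hu.c2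
    have hPnc' := hPnc n
    change ∫ x in (0 : ℝ)..1, (m * deriv (deriv (W (φ n))) x + Pn n x) ^ 2 ≤ _ at h1
    calc ∫ x in (0 : ℝ)..1, (deriv (deriv (W (φ n))) x - deriv (deriv u) x) ^ 2
        ≤ ∫ x in (0 : ℝ)..1, (2 / m ^ 2) * ((m * deriv (deriv (W (φ n))) x + Pn n x) ^ 2
            + (Pn n x - Pf a c0 c1 R w d0 d1 x) ^ 2) := by
          refine intervalIntegral.integral_mono_on (by norm_num) ?_ ?_ ?_
          · apply Continuous.intervalIntegrable; fun_prop
          · apply Continuous.intervalIntegrable; fun_prop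
          · intro x _
            simp only [hur]
            generalize Pf a c0 c1 R w d0 d1 x = p
            generalize Pn n x = q
            generalize deriv (deriv (W (φ n))) x = v
            have : (v - -p / m) = ((m * v + q) - (q - p)) / m := by field_simp; ring
            rw [this, div_pow, div_mul_eq_mul_div]
            refine div_le_div_of_nonneg_right ?_ (sq_nonneg m)
            nlinarith [sq_nonneg ((m * v + q) + (q - p))]
      _ = (2 / m ^ 2) * ((∫ x in (0 : ℝ)..1, (m * deriv (deriv (W (φ n))) x + Pn n x) ^ 2)
            + ∫ x in (0 : ℝ)..1, (Pn n x - Pf a c0 c1 R w d0 d1 x) ^ 2) := by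
          rw [intervalIntegral.integral_const_mul, intervalIntegral.integral_add]
          all_goals apply Continuous.intervalIntegrable; fun_prop
      _ ≤ _ := mul_le_mul_of_nonneg_left (add_le_add h1 h2) (by positivity)
  have hIlim : Filter.Tendsto (fun n => ∫ x in (0 : ℝ)..1, (deriv (deriv (W (φ n))) x - deriv (deriv u) x) ^ 2)
        Filter.atTop (nhds 0) := by
    refine squeeze_zero (fun n => intervalIntegral.integral_nonneg (by norm_num) fun x _ => sq_nonneg _) hI ?_
    have := (((hlim.comp hφ.tendsto_atTop).const_mul C).add (hη.pow 2)).const_mul (2 / m ^ 2)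
    simpa using this
  -- pointwise convergence
  have hpt := fun n => poincare (((hW (φ n)).comb hu (-1)).1)
  have hpt' : ∀ n, ∀ x ∈ Icc (0 : ℝ) 1, (deriv (W (φ n)) x - deriv u x) ^ 2
        ≤ (∫ x in (0 : ℝ)..1, (deriv (deriv (W (φ n))) x - deriv (deriv u) x) ^ 2) ∧
      (W (φ n) x - u x) ^ 2 ≤ ∫ x in (0 : ℝ)..1, (deriv (deriv (W (φ n))) x - deriv (deriv u) x) ^ 2 := by
    intro n x hx
    have h := hpt n x hx
    rw [((hW (φ n)).comb hu (-1)).2.2, ((hW (φ n)).comb hu (-1)).2.1] at h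
    simpa only [neg_one_mul, ← sub_eq_add_neg] using h
  have sqz : ∀ (y : ℕ → ℝ) (l l' : ℝ), Filter.Tendsto y Filter.atTop (nhds l') →
      (∀ n, (y n - l) ^ 2 ≤ ∫ x in (0 : ℝ)..1, (deriv (deriv (W (φ n))) x - deriv (deriv u) x) ^ 2) →
      l' = l := by
    intro y l l' hy h
    have h1 := squeeze_zero (fun n => sq_nonneg _) h hIlim
    have h2 := (hy.sub_const l).pow 2
    have h3 := tendsto_nhds_unique h2 h1
    have h4 := pow_eq_zero_iff (two_ne_zero) |>.1 h3
    linarith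
  have wu : ∀ x ∈ Icc (0 : ℝ) 1, w x = u x := by
    intro x hx
    refine sqz (fun n => W (φ n) x) _ _ ?_ (fun n => (hpt' n x hx).2)
    rw [tendsto_iff_dist_tendsto_zero]
    exact squeeze_zero (fun n => dist_nonneg) (fun n => hwδ n x hx) hδ
  have e0 : d0 = deriv u 0 := sqz _ _ _ hd0 (fun n => (hpt' n 0 (by simp)).1)
  have e1 : d1 = deriv u 1 := sqz _ _ _ hd1 (fun n => (hpt' n 1 (by simp)).1)
  refine ⟨φ, hφ, u, R, hu, hR, ?_, ?_, hIlim⟩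
  · intro x hx
    simp only [hRb, wu x hx]
  · intro x hx
    rw [hur, ← e0, ← e1]
    simp only [Pf, wu x hx]
    field_simp
    ring

lemma deriv_eqOn_Icc01 {f g : ℝ → ℝ} (hf : Differentiable ℝ f) (hg : Differentiable ℝ g)
    (h : EqOn f g (Icc 0 1)) : EqOn (deriv f) (deriv g) (Icc 0 1) := by
  intro x hx
  have hu := uniqueDiffOn_Icc (zero_lt_one (α := ℝ)) x hx
  rw [← (hf x).derivWithin hu, ← (hg x).derivWithin hu]
  exact derivWithin_congr h (h hx)

lemma smooth_ext (m a c0 c1 : ℝ) (hm : 0 < m) (b : ℝ → ℝ) (hb : ContDiff ℝ (⊤ : ℕ∞) b)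
    (w R : ℝ → ℝ) (hw : Dr w) (hR : Dr R)
    (hRb : ∀ x ∈ Icc (0 : ℝ) 1, deriv (deriv R) x = b x * w x)
    (hE : ∀ x ∈ Icc (0 : ℝ) 1, m * deriv (deriv w) x + Pf a c0 c1 R w (deriv w 0) (deriv w 1) x = 0) :
    ∃ z : ℝ → ℝ, ContDiff ℝ (⊤ : ℕ∞) z ∧ EqOn z w (Icc 0 1) := by
  let f : ℝ × (ℝ × ℝ) × (ℝ × ℝ) → ℝ × (ℝ × ℝ) × (ℝ × ℝ) := fun y =>
    (1, (y.2.1.2, -(-a * y.2.1.1 + y.2.2.1 + (-c0 * deriv w 0 * (1 - y.1) + c1 * deriv w 1 * y.1)) / m),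
      (y.2.2.2, b y.1 * y.2.1.1))
  have hf : ContDiff ℝ (⊤ : ℕ∞) f := by
    have : ContDiff ℝ (⊤ : ℕ∞) (fun y : ℝ × (ℝ × ℝ) × (ℝ × ℝ) => b y.1) := hb.comp contDiff_fst
    simp only [f]
    fun_prop
  obtain ⟨ε, hε, Z, hZ, hZ'⟩ := extend_ode f hf
    (fun t => (t, (w t, deriv w t), (R t, deriv R t))) (by
      intro t ht
      have h := (hasDerivAt_id t).prodMk (((hw.d0 t).prodMk (hw.d1 t)).prodMk ((hR.d0 t).prodMk (hR.d1 t)))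
      refine h.congr_deriv ?_
      have := hE t ht
      simp only [f, hRb t ht, Prod.mk.injEq, true_and, and_true]
      simp only [Pf] at this
      rw [eq_div_iff hm.ne']
      linarith)
  have hs := smooth_ode f hf Z _ isOpen_Ioo hZ'
  obtain ⟨z, hz, hzz⟩ := cutoff_ext ε hε (fun t => (Z t).2.1.1) (by fun_prop)
  refine ⟨z, hz, fun x hx => ?_⟩
  rw [hzz hx]
  simp [hZ hx]

lemma Qf_smul (m a c0 c1 : ℝ) (b : ℝ → ℝ) (V : ℝ → ℝ) (hV : Dr V) (t : ℝ) :
    Qf m a b c0 c1 (fun x => t * V x) = t ^ 2 * Qf m a b c0 c1 V := by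
  unfold Qf
  rw [(hV.smul t).2.2, (hV.smul t).2.1, mul_add, mul_add, ← intervalIntegral.integral_const_mul]
  congr 1
  · congr 1
    · refine intervalIntegral.integral_congr fun x _ => ?_
      ring
    · ring
  · ring

lemma Qf_ge (m a c0 c1 : ℝ) (b : ℝ → ℝ) (hb : Continuous b) (ha : 0 ≤ a) (h0 : 0 ≤ c0) (h1 : 0 ≤ c1)
    (hbp : ∀ x ∈ Icc (0 : ℝ) 1, 0 ≤ b x) (V : ℝ → ℝ) (hV : Dr V) :
    m * (∫ x in (0 : ℝ)..1, deriv (deriv V) x ^ 2) ≤ Qf m a b c0 c1 V := by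
  have := hV.c0; have := hV.c1; have := hV.c2
  have i1 : m * (∫ x in (0 : ℝ)..1, deriv (deriv V) x ^ 2) ≤
      ∫ x in (0 : ℝ)..1, (m * deriv (deriv V) x ^ 2 + a * deriv V x ^ 2 + b x * V x ^ 2) := by
    rw [← intervalIntegral.integral_const_mul]
    refine intervalIntegral.integral_mono_on (by norm_num) ?_ ?_ ?_
    · apply Continuous.intervalIntegrable; fun_prop
    · apply Continuous.intervalIntegrable; fun_prop
    · intro x hx
      have := mul_nonneg ha (sq_nonneg (deriv V x))
      have := mul_nonneg (hbp x hx) (sq_nonneg (V x))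
      linarith
  have := mul_nonneg h0 (sq_nonneg (deriv V 0))
  have := mul_nonneg h1 (sq_nonneg (deriv V 1))
  unfold Qf
  linarith

lemma Qf_congr (m a c0 c1 : ℝ) (b : ℝ → ℝ) (V W : ℝ → ℝ) (hV : Dr V) (hW : Dr W)
    (h : EqOn V W (Icc 0 1)) : Qf m a b c0 c1 V = Qf m a b c0 c1 W := by
  have e1 := deriv_eqOn_Icc01 ((c2_iff V).1 hV.1).1 ((c2_iff W).1 hW.1).1 h
  have e2 := deriv_eqOn_Icc01 ((c2_iff V).1 hV.1).2.1 ((c2_iff W).1 hW.1).2.1 e1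
  unfold Qf
  rw [e1 (show (0 : ℝ) ∈ Icc (0 : ℝ) 1 by simp), e1 (show (1 : ℝ) ∈ Icc (0 : ℝ) 1 by simp)]
  congr 2
  refine intervalIntegral.integral_congr fun x hx => ?_
  rw [uIcc_of_le (by norm_num)] at hx
  simp only [e1 hx, e2 hx, h hx]

lemma J_eq (ξ : ℝ) (V : ℝ → ℝ) : Jfun ξ V = Qf 0 1 (fun _ => ξ ^ 2) 0 0 V := by
  unfold Jfun Qf
  rw [integral_Icc_eq_integral_Ioc, ← intervalIntegral.integral_of_le (by norm_num)]
  simp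

lemma EJ_eq (μ g k0 k1 s ξ Λ : ℝ) (θb : ℝ → ℝ) (hθ : Continuous (deriv θb)) (V : ℝ → ℝ) (hV : Dr V) :
    Efun μ g k0 k1 θb s ξ V - Λ * Jfun ξ V =
      Qf (s * μ) (2 * (s * μ) * ξ ^ 2 - Λ)
        (fun x => s * μ * ξ ^ 4 + g * ξ ^ 2 * deriv θb x - Λ * ξ ^ 2) (-s * k0) (-s * k1) V := by
  have := hV.c0; have := hV.c1; have := hV.c2
  unfold Efun E0 E1 E2 Jfun Qf
  simp only [integral_Icc_eq_integral_Ioc]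
  simp only [← intervalIntegral.integral_of_le (zero_le_one (α := ℝ))]
  have e : ∫ x in (0 : ℝ)..1, (s * μ * deriv (deriv V) x ^ 2 + (2 * (s * μ) * ξ ^ 2 - Λ) * deriv V x ^ 2
      + (s * μ * ξ ^ 4 + g * ξ ^ 2 * deriv θb x - Λ * ξ ^ 2) * V x ^ 2)
      = (s * μ) * (∫ x in (0 : ℝ)..1, (deriv (deriv V) x ^ 2 + 2 * ξ ^ 2 * deriv V x ^ 2 + ξ ^ 4 * V x ^ 2))
        + g * ξ ^ 2 * (∫ x in (0 : ℝ)..1, deriv θb x * V x ^ 2)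
        - Λ * ∫ x in (0 : ℝ)..1, (deriv V x ^ 2 + ξ ^ 2 * V x ^ 2) := by
    rw [← intervalIntegral.integral_const_mul, ← intervalIntegral.integral_const_mul,
      ← intervalIntegral.integral_const_mul, ← intervalIntegral.integral_add,
      ← intervalIntegral.integral_sub]
    · refine intervalIntegral.integral_congr fun x _ => ?_
      ring
    all_goals apply Continuous.intervalIntegrable; fun_prop
  rw [e]; ring

lemma J_nonneg (ξ : ℝ) (V : ℝ → ℝ) : 0 ≤ Jfun ξ V :=
  integral_nonneg fun x => by positivity

lemma J_pos_exists (ξ : ℝ) (hξ : ξ ≠ 0) : ∃ V, Dr V ∧ 0 < Jfun ξ V := by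
  obtain ⟨hV, h1, -⟩ := dr_of_hasDeriv (fun x => x * (1 - x)) (fun x => 1 * (1 - x) + x * (-1))
    (fun _ => -2) (by simp) (by simp)
    (fun x => (hasDerivAt_id x).mul ((hasDerivAt_id x).const_sub 1))
    (fun x => by
      have h := (((hasDerivAt_id x).const_sub 1).const_mul 1).add ((hasDerivAt_id x).mul_const (-1))
      refine h.congr_deriv ?_
      norm_num) continuous_const
  refine ⟨_, hV, ?_⟩
  unfold Jfun
  rw [integral_Icc_eq_integral_Ioc, ← intervalIntegral.integral_of_le (by norm_num), h1]
  refine intervalIntegral.intervalIntegral_pos_of_pos_on ?_ ?_ (by norm_num)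
  · apply Continuous.intervalIntegrable; fun_prop
  · intro x hx
    have : 0 < x * (1 - x) := mul_pos hx.1 (by linarith [hx.2])
    have : 0 < ξ ^ 2 := by positivity
    positivity

lemma J_lim (ξ : ℝ) (W : ℕ → ℝ → ℝ) (hW : ∀ n, Dr (W n)) (w : ℝ → ℝ) (hw : Dr w) (M : ℝ)
    (hbd : ∀ n, ∫ x in (0 : ℝ)..1, deriv (deriv (W n)) x ^ 2 ≤ M ^ 2)
    (h : Filter.Tendsto (fun n => ∫ x in (0 : ℝ)..1, (deriv (deriv (W n)) x - deriv (deriv w) x) ^ 2)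
        Filter.atTop (nhds 0)) :
    Filter.Tendsto (fun n => Jfun ξ (W n)) Filter.atTop (nhds (Jfun ξ w)) := by
  have hpt' : ∀ n, ∀ x ∈ Icc (0 : ℝ) 1, (deriv (W n) x - deriv w x) ^ 2
        ≤ (∫ x in (0 : ℝ)..1, (deriv (deriv (W n)) x - deriv (deriv w) x) ^ 2) ∧
      (W n x - w x) ^ 2 ≤ ∫ x in (0 : ℝ)..1, (deriv (deriv (W n)) x - deriv (deriv w) x) ^ 2 := by
    intro n x hx
    have h := poincare (((hW n).comb hw (-1)).1) x hx
    rw [((hW n).comb hw (-1)).2.2, ((hW n).comb hw (-1)).2.1] at h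
    simpa only [neg_one_mul, ← sub_eq_add_neg] using h
  have sqz : ∀ (y : ℕ → ℝ) (l : ℝ),
      (∀ n, (y n - l) ^ 2 ≤ ∫ x in (0 : ℝ)..1, (deriv (deriv (W n)) x - deriv (deriv w) x) ^ 2) →
      Filter.Tendsto y Filter.atTop (nhds l) := by
    intro y l hy
    rw [tendsto_iff_dist_tendsto_zero]
    have h1 := (squeeze_zero (fun n => sq_nonneg _) hy h).sqrt
    simpa [Real.sqrt_sq_eq_abs, Real.dist_eq] using h1
  unfold Jfun
  simp only [integral_Icc_eq_integral_Ioc]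
  simp only [← intervalIntegral.integral_of_le (zero_le_one (α := ℝ))]
  refine intervalIntegral.tendsto_integral_filter_of_dominated_convergence
    (fun _ => M ^ 2 + ξ ^ 2 * M ^ 2) ?_ ?_ (by simp) ?_
  · refine Filter.Eventually.of_forall fun n => ?_
    have := (hW n).c0; have := (hW n).c1
    apply Continuous.aestronglyMeasurable; fun_prop
  · refine Filter.Eventually.of_forall fun n => Filter.Eventually.of_forall fun x hx => ?_
    rw [uIoc_of_le (by norm_num)] at hx
    have p := poincare (hW n) x (Ioc_subset_Icc_self hx)
    rw [Real.norm_of_nonneg (by positivity)]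
    exact add_le_add (p.1.trans (hbd n)) (mul_le_mul_of_nonneg_left (p.2.trans (hbd n)) (sq_nonneg ξ))
  · refine Filter.Eventually.of_forall fun x hx => ?_
    rw [uIoc_of_le (by norm_num)] at hx
    have hx' := Ioc_subset_Icc_self hx
    exact ((sqz _ _ fun n => (hpt' n x hx').1).pow 2).add
      (((sqz _ _ fun n => (hpt' n x hx').2).pow 2).const_mul _)

/-- Existence of a smooth minimizer for the modified variational problem. -/
theorem minimizer_exists (μ g k0 k1 : ℝ) (hμ : 0 < μ) (hg : 0 < g)
    (hk0 : k0 ≤ 0) (hk1 : k1 ≤ 0) (θb : ℝ → ℝ) (hθb : ContDiff ℝ (⊤ : ℕ∞) θb)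
    (ξ : ℝ) (hξ : ξ ≠ 0) (s : ℝ) (hs : 0 < s) :
    BddBelow ((fun W => Efun μ g k0 k1 θb s ξ W) '' Adm ξ) ∧
    ∃ W₀ : ℝ → ℝ, ContDiff ℝ (⊤ : ℕ∞) W₀ ∧ W₀ 0 = 0 ∧ W₀ 1 = 0 ∧ Jfun ξ W₀ = 1 ∧
      Efun μ g k0 k1 θb s ξ W₀ = Phi μ g k0 k1 θb s ξ := by
  have hθs : ContDiff ℝ (⊤ : ℕ∞) (deriv θb) := (contDiff_infty_iff_deriv.1 hθb).2
  have hθ : Continuous (deriv θb) := hθs.continuous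
  have hm : 0 < s * μ := mul_pos hs hμ
  obtain ⟨T, hT⟩ := isCompact_Icc.exists_bound_of_continuousOn (hθ.continuousOn (s := Icc (0 : ℝ) 1))
  simp only [Real.norm_eq_abs] at hT
  have hT0 : 0 ≤ T := (abs_nonneg _).trans (hT 0 (by simp))
  have coer : ∀ V, Dr V → s * μ * (∫ x in (0 : ℝ)..1, deriv (deriv V) x ^ 2) ≤
      Efun μ g k0 k1 θb s ξ V + g * T * Jfun ξ V := by
    intro V hV
    have h := EJ_eq μ g k0 k1 s ξ (-(g * T)) θb hθ V hV
    have h2 := Qf_ge (s * μ) (2 * (s * μ) * ξ ^ 2 - (-(g * T))) (-s * k0) (-s * k1)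
      (fun x => s * μ * ξ ^ 4 + g * ξ ^ 2 * deriv θb x - (-(g * T)) * ξ ^ 2) (by fun_prop)
      (by have := mul_nonneg hg.le hT0; have := mul_nonneg hm.le (sq_nonneg ξ); linarith)
      (by nlinarith) (by nlinarith) (by
        intro x hx
        have h1 := (abs_le.1 (hT x hx)).1
        have h2 : 0 ≤ g * ξ ^ 2 * (deriv θb x + T) := mul_nonneg (by positivity) (by linarith)
        have h3 : 0 ≤ s * μ * ξ ^ 4 := by positivity
        linarith) V hV
    rw [← h] at h2
    linarith
  have hint0 : ∀ V : ℝ → ℝ, 0 ≤ ∫ x in (0 : ℝ)..1, deriv (deriv V) x ^ 2 := fun V =>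
    intervalIntegral.integral_nonneg (by norm_num) fun x _ => sq_nonneg _
  have hbb : BddBelow ((fun W => Efun μ g k0 k1 θb s ξ W) '' Adm ξ) := by
    refine ⟨-(g * T), ?_⟩
    rintro _ ⟨W, ⟨hW, h0, h1, hJ⟩, rfl⟩
    have := coer W ⟨hW, h0, h1⟩
    have := mul_nonneg hm.le (hint0 W)
    rw [hJ] at *
    simp only
    linarith
  refine ⟨hbb, ?_⟩
  have hEq : ∀ V, Dr V → ∀ t : ℝ, Efun μ g k0 k1 θb s ξ (fun x => t * V x)
      = t ^ 2 * Efun μ g k0 k1 θb s ξ V := by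
    intro V hV t
    have h := EJ_eq μ g k0 k1 s ξ 0 θb hθ V hV
    have h' := EJ_eq μ g k0 k1 s ξ 0 θb hθ _ (hV.smul t).1
    rw [Qf_smul _ _ _ _ _ V hV, ← h] at h'
    simpa using h'
  have hJq : ∀ V, Dr V → ∀ t : ℝ, Jfun ξ (fun x => t * V x) = t ^ 2 * Jfun ξ V := by
    intro V hV t
    rw [J_eq, J_eq, Qf_smul _ _ _ _ _ V hV]
  have norml : ∀ V, Dr V → 0 < Jfun ξ V → (fun x => (Real.sqrt (Jfun ξ V))⁻¹ * V x) ∈ Adm ξ := by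
    intro V hV hJ
    have h := (hV.smul (Real.sqrt (Jfun ξ V))⁻¹).1
    refine ⟨h.1, h.2.1, h.2.2, ?_⟩
    rw [hJq V hV, inv_pow, Real.sq_sqrt hJ.le, inv_mul_cancel₀ hJ.ne']
  set Φ := Phi μ g k0 k1 θb s ξ with hΦ
  have hne : ((fun W => Efun μ g k0 k1 θb s ξ W) '' Adm ξ).Nonempty := by
    obtain ⟨V, hV, hJ⟩ := J_pos_exists ξ hξ
    exact ⟨_, _, norml V hV hJ, rfl⟩
  have hQ0 : ∀ V, Dr V → 0 ≤ Efun μ g k0 k1 θb s ξ V - Φ * Jfun ξ V := by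
    intro V hV
    rcases (J_nonneg ξ V).eq_or_lt with hJ | hJ
    · have := coer V hV
      have := mul_nonneg hm.le (hint0 V)
      rw [← hJ] at *
      linarith
    · have h1 : Φ ≤ Efun μ g k0 k1 θb s ξ (fun x => (Real.sqrt (Jfun ξ V))⁻¹ * V x) :=
        csInf_le hbb ⟨_, norml V hV hJ, rfl⟩
      rw [hEq V hV, inv_pow, Real.sq_sqrt hJ.le, inv_mul_eq_div, le_div_iff₀ hJ] at h1
      linarith
  -- minimizing sequence
  have hseq : ∀ n : ℕ, ∃ W ∈ Adm ξ, Efun μ g k0 k1 θb s ξ W < Φ + 1 / ((n : ℝ) + 1) := by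
    intro n
    obtain ⟨_, ⟨W, hW, rfl⟩, h⟩ := exists_lt_of_csInf_lt hne
      (show Φ < Φ + 1 / ((n : ℝ) + 1) by have : 0 < 1 / ((n : ℝ) + 1) := by positivity
                                         linarith)
    exact ⟨W, hW, h⟩
  choose W hWA hWE using hseq
  have hW : ∀ n, Dr (W n) := fun n => ⟨(hWA n).1, (hWA n).2.1, (hWA n).2.2.1⟩
  have hJ1 : ∀ n, Jfun ξ (W n) = 1 := fun n => (hWA n).2.2.2
  have hbd : ∀ n, ∫ x in (0 : ℝ)..1, deriv (deriv (W n)) x ^ 2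
      ≤ (Real.sqrt ((Φ + 1 + g * T) / (s * μ))) ^ 2 := by
    intro n
    have h1 := coer _ (hW n)
    rw [hJ1] at h1
    have h2 : 1 / ((n : ℝ) + 1) ≤ 1 := by
      rw [div_le_one (by positivity)]
      have : (0 : ℝ) ≤ n := by positivity
      linarith
    have h3 : ∫ x in (0 : ℝ)..1, deriv (deriv (W n)) x ^ 2 ≤ (Φ + 1 + g * T) / (s * μ) := by
      rw [le_div_iff₀ hm]
      have := hWE n
      linarith
    rwa [Real.sq_sqrt ((hint0 _).trans h3)]
  set b : ℝ → ℝ := fun x => s * μ * ξ ^ 4 + g * ξ ^ 2 * deriv θb x - Φ * ξ ^ 2 with hbdef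
  have hbs : ContDiff ℝ (⊤ : ℕ∞) b := by simp only [hbdef]; fun_prop
  have hE := fun V hV => EJ_eq μ g k0 k1 s ξ Φ θb hθ V hV
  obtain ⟨φ, hφ, w, R, hw, hR, hRb, hode, hcv⟩ := limit_exists (s * μ) (2 * (s * μ) * ξ ^ 2 - Φ)
    (-s * k0) (-s * k1) hm b hbs.continuous (fun V hV => by rw [← hE V hV]; exact hQ0 V hV) W hW _
    (Real.sqrt_nonneg _) hbd (by
      refine squeeze_zero (fun n => ?_) (fun n => ?_) (tendsto_one_div_add_atTop_nhds_zero_nat (𝕜 := ℝ))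
      · rw [← hE _ (hW n)]; exact hQ0 _ (hW n)
      · rw [← hE _ (hW n), hJ1]; linarith [hWE n])
  have hJw : Jfun ξ w = 1 := by
    have h1 := J_lim ξ (fun n => W (φ n)) (fun n => hW _) w hw _ (fun n => hbd _) hcv
    simp only [hJ1] at h1
    exact tendsto_nhds_unique h1 tendsto_const_nhds |>.symm ▸ rfl
  have hQw := Qf_zero (s * μ) (2 * (s * μ) * ξ ^ 2 - Φ) (-s * k0) (-s * k1) b hbs.continuous w R hw hR hRb hode
  obtain ⟨z, hz, hzw⟩ := smooth_ext (s * μ) (2 * (s * μ) * ξ ^ 2 - Φ) (-s * k0) (-s * k1) hm b hbs w R hw hR hRb hode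
  have hzD : Dr z := by
    refine ⟨by exact_mod_cast contDiff_infty.1 hz 2, ?_, ?_⟩
    · rw [hzw (by simp), hw.2.1]
    · rw [hzw (by simp), hw.2.2]
  have hJz : Jfun ξ z = 1 := by
    rw [J_eq, Qf_congr _ _ _ _ _ z w hzD hw hzw, ← J_eq, hJw]
  refine ⟨z, hz, hzD.2.1, hzD.2.2, hJz, ?_⟩
  have := hE z hzD
  rw [Qf_congr _ _ _ _ _ z w hzD hw hzw, hQw, hJz] at this
  linarith
end
end

section
/- Existence of a growing normal mode for the linearized Rayleigh–Taylor problem: assume the Rayleigh–Taylor condition. Then for every ξ ≠ 0 there exist a number λ > 0 and a smooth function W ∈ C^∞([0,1]), not identically zero, such that −λ²(D²W − ξ²W) = −λμ(D⁴W − 2ξ²D²W + ξ⁴W) − gξ²·Dθ̄·W on [0,1], with the boundary conditions W(0) = W(1) = 0, D²W(1) = (k₁/μ)·DW(1), and D²W(0) = −(k₀/μ)·DW(0). -/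
open MeasureTheory Set

noncomputable section

namespace RT

/-- primitive -/
def P : C(ℝ, ℝ) →ₗ[ℝ] C(ℝ, ℝ) where
  toFun v := ⟨fun x => ∫ y in (0:ℝ)..x, v y,
    intervalIntegral.continuous_primitive (fun a b => v.continuous.intervalIntegrable a b) 0⟩
  map_add' u v := by
    ext x
    simp only [ContinuousMap.coe_mk, ContinuousMap.add_apply]
    exact intervalIntegral.integral_add (u.continuous.intervalIntegrable _ _)
      (v.continuous.intervalIntegrable _ _)
  map_smul' c v := by
    ext x
    simp [intervalIntegral.integral_const_mul]

lemma P_apply (v : C(ℝ, ℝ)) (x : ℝ) : P v x = ∫ y in (0:ℝ)..x, v y := rfl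

lemma P_deriv (v : C(ℝ, ℝ)) (x : ℝ) : HasDerivAt (P v) (v x) x :=
  intervalIntegral.integral_hasDerivAt_right (v.continuous.intervalIntegrable _ _)
    (v.continuous.stronglyMeasurableAtFilter _ _) v.continuous.continuousAt

lemma P_zero (v : C(ℝ, ℝ)) : P v 0 = 0 := by simp [P_apply]

def ip : C(ℝ, ℝ) →ₗ[ℝ] C(ℝ, ℝ) →ₗ[ℝ] ℝ :=
  LinearMap.mk₂ ℝ (fun u v => ∫ y in (0:ℝ)..1, u y * v y)
    (by
      intro a b c
      simp only [ContinuousMap.add_apply, add_mul]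
      exact intervalIntegral.integral_add ((a.continuous.mul c.continuous).intervalIntegrable _ _)
        ((b.continuous.mul c.continuous).intervalIntegrable _ _))
    (by
      intro r a b
      simp [mul_assoc, intervalIntegral.integral_const_mul])
    (by
      intro a b c
      simp only [ContinuousMap.add_apply, mul_add]
      exact intervalIntegral.integral_add ((a.continuous.mul b.continuous).intervalIntegrable _ _)
        ((a.continuous.mul c.continuous).intervalIntegrable _ _))
    (by
      intro r a b
      simp [mul_left_comm, intervalIntegral.integral_const_mul])

lemma ip_apply (u v : C(ℝ, ℝ)) : ip u v = ∫ y in (0:ℝ)..1, u y * v y := rfl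

lemma ip_comm (u v : C(ℝ, ℝ)) : ip u v = ip v u := by
  simp only [ip_apply, mul_comm]

lemma ip_self_nonneg (u : C(ℝ, ℝ)) : 0 ≤ ip u u := by
  rw [ip_apply]
  exact intervalIntegral.integral_nonneg zero_le_one (fun x _ => mul_self_nonneg _)

def D : C(ℝ, ℝ) →ₗ[ℝ] C(ℝ, ℝ) where
  toFun v := P v - ContinuousMap.const ℝ (P (P v) 1)
  map_add' u v := by
    ext x
    simp
    ring
  map_smul' c v := by
    ext x
    simp
    ring

lemma D_apply (v : C(ℝ, ℝ)) (x : ℝ) : D v x = P v x - P (P v) 1 := rfl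

lemma D_deriv (v : C(ℝ, ℝ)) (x : ℝ) : HasDerivAt (D v) (v x) x :=
  (P_deriv v x).sub_const _

def G : C(ℝ, ℝ) →ₗ[ℝ] C(ℝ, ℝ) := P.comp D

lemma G_apply (v : C(ℝ, ℝ)) : G v = P (D v) := rfl

lemma G_deriv (v : C(ℝ, ℝ)) (x : ℝ) : HasDerivAt (G v) (D v x) x := P_deriv _ _

lemma G_zero (v : C(ℝ, ℝ)) : G v 0 = 0 := P_zero _

lemma G_one (v : C(ℝ, ℝ)) : G v 1 = 0 := by
  rw [G_apply, P_apply]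
  simp only [D_apply]
  rw [intervalIntegral.integral_sub ((P v).continuous.intervalIntegrable _ _) (by simp)]
  simp [P_apply (P v)]

/-- integration by parts with `z = D u`, `z' = u`. -/
lemma parts (f f' u : C(ℝ, ℝ)) (hf : ∀ x, HasDerivAt f (f' x) x) :
    ip f u = f 1 * D u 1 - f 0 * D u 0 - ip f' (D u) := by
  rw [ip_apply, ip_apply]
  exact intervalIntegral.integral_mul_deriv_eq_deriv_mul (fun x _ => hf x) (fun x _ => D_deriv u x)
    (f'.continuous.intervalIntegrable _ _) (u.continuous.intervalIntegrable _ _)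

lemma ip_G (v u : C(ℝ, ℝ)) : ip (G v) u = - ip (D v) (D u) := by
  rw [parts (G v) (D v) u (G_deriv v), G_zero, G_one]; ring

lemma ip_G_symm (v u : C(ℝ, ℝ)) : ip (G v) u = ip v (G u) := by
  rw [ip_comm v, ip_G, ip_G, ip_comm]

def X : C(ℝ, ℝ) := ContinuousMap.id ℝ

lemma ip_one_D (u : C(ℝ, ℝ)) : ip 1 (D u) = 0 := by
  have h := G_one u
  rw [G_apply, P_apply] at h
  rw [ip_apply]; simpa using h

lemma D_one (u : C(ℝ, ℝ)) : D u 1 = ip X u := by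
  rw [parts X 1 u (fun x => hasDerivAt_id x), ip_one_D]
  simp [X]

lemma D_zero (u : C(ℝ, ℝ)) : D u 0 = - ip (1 - X) u := by
  rw [parts (1 - X) (-1) u (fun x => (hasDerivAt_id x).const_sub 1)]
  simp [X, ip_one_D]

lemma P_bound (v : C(ℝ, ℝ)) (x : ℝ) (hx : x ∈ Icc (0:ℝ) 1) : (P v x) ^ 2 ≤ ip v v := by
  have h1 : 0 ≤ ∫ y in (0:ℝ)..x, (v y - P v x) ^ 2 :=
    intervalIntegral.integral_nonneg hx.1 (fun _ _ => sq_nonneg _)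
  have h2 : ∫ y in (0:ℝ)..x, (v y - P v x) ^ 2 =
      (∫ y in (0:ℝ)..x, v y * v y) - 2 * P v x * P v x + x * P v x ^ 2 := by
    have : ∀ y, (v y - P v x) ^ 2 = (v y * v y - (2 * P v x) * v y) + P v x ^ 2 := by
      intro y; ring
    simp only [this]
    have hv := v.continuous
    rw [intervalIntegral.integral_add (Continuous.intervalIntegrable (by fun_prop) _ _) (by simp),
      intervalIntegral.integral_sub (Continuous.intervalIntegrable (by fun_prop) _ _)
        (Continuous.intervalIntegrable (by fun_prop) _ _), intervalIntegral.integral_const_mul,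
      ← P_apply]
    simp
  have h3 : (∫ y in (0:ℝ)..x, v y * v y) ≤ ip v v := by
    rw [ip_apply]
    exact intervalIntegral.integral_mono_interval le_rfl hx.1 hx.2
      (Filter.Eventually.of_forall fun y => mul_self_nonneg _)
      ((v.continuous.mul v.continuous).intervalIntegrable _ _)
  nlinarith [sq_nonneg (P v x), hx.2]

lemma ip_le_of_bound (v : C(ℝ, ℝ)) (c : ℝ) (h : ∀ x ∈ Icc (0:ℝ) 1, (v x) ^ 2 ≤ c) :
    ip v v ≤ c := by
  rw [ip_apply]
  calc ∫ y in (0:ℝ)..1, v y * v y ≤ ∫ y in (0:ℝ)..1, c := by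
        apply intervalIntegral.integral_mono_on zero_le_one
          ((v.continuous.mul v.continuous).intervalIntegrable _ _) (by simp)
        intro x hx
        have := h x hx
        show v x * v x ≤ c
        nlinarith
    _ = c := by simp

lemma D_bound (v : C(ℝ, ℝ)) (x : ℝ) (hx : x ∈ Icc (0:ℝ) 1) : (D v x) ^ 2 ≤ 4 * ip v v := by
  rw [D_apply]
  have h1 := P_bound v x hx
  have h2 := P_bound (P v) 1 (by simp)
  have h3 := ip_le_of_bound (P v) _ (P_bound v)
  nlinarith [sq_nonneg (P v x + P (P v) 1)]

lemma D_ip_bound (v : C(ℝ, ℝ)) : ip (D v) (D v) ≤ 4 * ip v v := ip_le_of_bound _ _ (D_bound v)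

lemma G_bound (v : C(ℝ, ℝ)) (x : ℝ) (hx : x ∈ Icc (0:ℝ) 1) : (G v x) ^ 2 ≤ 4 * ip v v :=
  (P_bound _ x hx).trans (D_ip_bound v)

lemma G_ip_bound (v : C(ℝ, ℝ)) : ip (G v) (G v) ≤ 4 * ip v v := ip_le_of_bound _ _ (G_bound v)

lemma G_lip (v : C(ℝ, ℝ)) (c : ℝ) (hc : 0 ≤ c) (hv : 4 * ip v v ≤ c ^ 2) (x y : ℝ)
    (hx : x ∈ Icc (0:ℝ) 1) (hy : y ∈ Icc (0:ℝ) 1) : |G v x - G v y| ≤ c * |x - y| := by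
  have := (convex_Icc (0:ℝ) 1).norm_image_sub_le_of_norm_hasDerivWithin_le (f := G v) (C := c)
    (fun x _ => (G_deriv v x).hasDerivWithinAt) (fun x hx => by
      rw [Real.norm_eq_abs]
      exact abs_le_of_sq_le_sq ((D_bound v x hx).trans hv) hc) hy hx
  simpa using this

lemma eq_zero_of_ip (v : C(ℝ, ℝ)) (h : ip v v = 0) (x : ℝ) (hx : x ∈ Icc (0:ℝ) 1) : v x = 0 := by
  by_contra hne
  have : 0 < ip v v := by
    rw [ip_apply]
    exact intervalIntegral.integral_pos zero_lt_one (v.continuous.mul v.continuous).continuousOn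
      (fun x _ => mul_self_nonneg _) ⟨x, hx, mul_self_pos.2 hne⟩
  linarith

/-- abstract lemma -/
lemma psd_bound (T : C(ℝ, ℝ) →ₗ[ℝ] C(ℝ, ℝ)) (hs : ∀ u v, ip (T u) v = ip u (T v))
    (h0 : ∀ v, 0 ≤ ip (T v) v) (C : ℝ) (hC : 0 < C) (hb : ∀ v, ip (T v) v ≤ C * ip v v)
    (v : C(ℝ, ℝ)) : ip (T v) (T v) ≤ C * ip (T v) v := by
  have h1 := h0 (v - C⁻¹ • T v)
  have h2 := hb (T v)
  simp only [map_sub, map_smul, LinearMap.sub_apply, LinearMap.smul_apply, smul_eq_mul] at h1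
  rw [hs (T v) v] at h1
  have h3 : C⁻¹ * (C⁻¹ * ip (T (T v)) (T v)) ≤ C⁻¹ * ip (T v) (T v) := by
    have : C⁻¹ * (C * ip (T v) (T v)) = ip (T v) (T v) := by field_simp
    rw [← this]
    gcongr
  have h4 : C⁻¹ * ip (T v) (T v) ≤ ip (T v) v := by linarith
  calc ip (T v) (T v) = C * (C⁻¹ * ip (T v) (T v)) := by field_simp
    _ ≤ _ := by gcongr

lemma ip_add_le (u v : C(ℝ, ℝ)) : ip (u + v) (u + v) ≤ 2 * ip u u + 2 * ip v v := by
  have := ip_self_nonneg (u - v)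
  simp only [map_sub, map_add, LinearMap.sub_apply, LinearMap.add_apply] at *
  linarith

end RT

namespace RT

/-- multiplication operator -/
def M (t : C(ℝ, ℝ)) : C(ℝ, ℝ) →ₗ[ℝ] C(ℝ, ℝ) := LinearMap.mulLeft ℝ t

lemma M_apply (t v : C(ℝ, ℝ)) (x : ℝ) : M t v x = t x * v x := rfl

lemma ip_M (t u v : C(ℝ, ℝ)) : ip (M t u) v = ip u (M t v) := by
  simp only [ip_apply, M_apply]
  congr 1; ext x; ring

/-- evaluation of `D` at a point -/
def ev (x : ℝ) : C(ℝ, ℝ) →ₗ[ℝ] ℝ where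
  toFun v := D v x
  map_add' u v := by simp
  map_smul' c v := by simp

lemma ev_apply (x : ℝ) (v : C(ℝ, ℝ)) : ev x v = D v x := rfl

/-- the compact part, with generic coefficients -/
def K (a b c d e : ℝ) (t : C(ℝ, ℝ)) : C(ℝ, ℝ) →ₗ[ℝ] C(ℝ, ℝ) :=
  -a • G + b • (G.comp G) + c • (G.comp ((M t).comp G)) + d • (ev 1).smulRight X
    - e • (ev 0).smulRight (1 - X)

lemma K_apply (a b c d e : ℝ) (t v : C(ℝ, ℝ)) : K a b c d e t v =
    -a • G v + b • G (G v) + c • G (M t (G v)) + d • (D v 1 • X) - e • (D v 0 • (1 - X)) := rfl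

def T (m a b c d e : ℝ) (t : C(ℝ, ℝ)) : C(ℝ, ℝ) →ₗ[ℝ] C(ℝ, ℝ) :=
  m • LinearMap.id + K a b c d e t

lemma T_apply (m a b c d e : ℝ) (t v : C(ℝ, ℝ)) : T m a b c d e t v = m • v + K a b c d e t v := rfl

lemma T_form (m a b c d e : ℝ) (t u v : C(ℝ, ℝ)) : ip (T m a b c d e t u) v =
    m * ip u v + a * ip (D u) (D v) + b * ip (G u) (G v) + c * ip (M t (G u)) (G v)
     + d * (D u 1 * D v 1) + e * (D u 0 * D v 0) := by
  rw [T_apply, K_apply]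
  simp only [map_sub, map_add, map_smul, LinearMap.sub_apply, LinearMap.add_apply,
    LinearMap.smul_apply, smul_eq_mul]
  rw [ip_G_symm (G u), ip_G_symm (M t (G u)), ip_G, D_one v, D_zero v]
  simp only [map_sub, LinearMap.sub_apply]
  ring

lemma T_symm (m a b c d e : ℝ) (t u v : C(ℝ, ℝ)) :
    ip (T m a b c d e t u) v = ip u (T m a b c d e t v) := by
  rw [ip_comm u, T_form, T_form, ip_comm u, ip_comm (D u), ip_comm (G u), ip_M, ip_comm (G u)]
  ring

lemma M_bound (t : C(ℝ, ℝ)) (C : ℝ) (ht : ∀ x ∈ Icc (0:ℝ) 1, |t x| ≤ C) (v : C(ℝ, ℝ)) :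
    |ip (M t v) v| ≤ C * ip v v := by
  have h : ∀ x ∈ Icc (0:ℝ) 1, |M t v x * v x| ≤ C * (v x * v x) := by
    intro x hx
    rw [M_apply, mul_assoc, abs_mul, abs_mul_self]
    exact mul_le_mul_of_nonneg_right (ht x hx) (mul_self_nonneg _)
  rw [ip_apply, ip_apply, ← intervalIntegral.integral_const_mul]
  refine (intervalIntegral.abs_integral_le_integral_abs zero_le_one).trans ?_
  have h1 := (M t v).continuous
  have h2 := v.continuous
  exact intervalIntegral.integral_mono_on zero_le_one
    (Continuous.intervalIntegrable (by fun_prop) _ _)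
    (Continuous.intervalIntegrable (by fun_prop) _ _) h

lemma T_upper (m a b c d e C : ℝ) (ha : 0 ≤ a) (hb : 0 ≤ b) (hc : 0 ≤ c) (hd : 0 ≤ d)
    (he : 0 ≤ e) (hC : 0 ≤ C) (t : C(ℝ, ℝ)) (ht : ∀ x ∈ Icc (0:ℝ) 1, |t x| ≤ C) (v : C(ℝ, ℝ)) :
    ip (T m a b c d e t v) v ≤ (m + 4 * a + 4 * b + 4 * c * C + 4 * d + 4 * e) * ip v v := by
  rw [T_form]
  have h1 := mul_le_mul_of_nonneg_left (D_ip_bound v) ha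
  have h2 := mul_le_mul_of_nonneg_left (G_ip_bound v) hb
  have h3 := mul_le_mul_of_nonneg_left (((le_abs_self _).trans (M_bound t C ht (G v))).trans
    (mul_le_mul_of_nonneg_left (G_ip_bound v) hC)) hc
  have h4 := mul_le_mul_of_nonneg_left (D_bound v 1 (by simp)) hd
  have h5 := mul_le_mul_of_nonneg_left (D_bound v 0 (by simp)) he
  nlinarith

lemma M_ip_bound (t : C(ℝ, ℝ)) (C : ℝ) (ht : ∀ x ∈ Icc (0:ℝ) 1, |t x| ≤ C) (v : C(ℝ, ℝ)) (c : ℝ)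
    (hv : ∀ x ∈ Icc (0:ℝ) 1, v x ^ 2 ≤ c) : ip (M t v) (M t v) ≤ C ^ 2 * c := by
  apply ip_le_of_bound
  intro x hx
  rw [M_apply, mul_pow]
  have : t x ^ 2 ≤ C ^ 2 := by
    rw [← sq_abs]; exact pow_le_pow_left₀ (abs_nonneg _) (ht x hx) 2
  exact mul_le_mul this (hv x hx) (sq_nonneg _) (sq_nonneg _)

/-- K maps the unit ball to an equi-Lipschitz, bounded family. -/
lemma K_lip (a b c d e C : ℝ) (hC : 0 ≤ C) (t : C(ℝ, ℝ)) (ht : ∀ x ∈ Icc (0:ℝ) 1, |t x| ≤ C) :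
    ∃ L : ℝ, 0 ≤ L ∧ ∀ v, ip v v ≤ 1 →
      (∀ x ∈ Icc (0:ℝ) 1, ∀ y ∈ Icc (0:ℝ) 1,
        |K a b c d e t v x - K a b c d e t v y| ≤ L * |x - y|) ∧
      (∀ x ∈ Icc (0:ℝ) 1, |K a b c d e t v x| ≤ L) := by
  have hsuff : ∃ L : ℝ, 0 ≤ L ∧ ∀ v, ip v v ≤ 1 →
      (∀ x ∈ Icc (0:ℝ) 1, ∀ y ∈ Icc (0:ℝ) 1,
        |K a b c d e t v x - K a b c d e t v y| ≤ L * |x - y|) := by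
    refine ⟨|a| * 2 + |b| * 4 + |c| * (4 * C) + |d| * 2 + |e| * 2, by positivity, ?_⟩
    intro v hv x hx y hy
    have h1 := G_lip v 2 (by norm_num) (by linarith) x y hx hy
    have h2 := G_lip (G v) 4 (by norm_num) (by linarith [G_ip_bound v]) x y hx hy
    have h3 := G_lip (M t (G v)) (4 * C) (by positivity)
      (by nlinarith [M_ip_bound t C ht (G v) 4 (fun x hx => by linarith [G_bound v x hx])]) x y hx hy
    have h4 : |D v 1| ≤ 2 := abs_le_of_sq_le_sq (by linarith [D_bound v 1 (by simp)]) (by norm_num)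
    have h5 : |D v 0| ≤ 2 := abs_le_of_sq_le_sq (by linarith [D_bound v 0 (by simp)]) (by norm_num)
    have key : K a b c d e t v x - K a b c d e t v y =
        -(a * (G v x - G v y)) + b * (G (G v) x - G (G v) y)
        + c * (G (M t (G v)) x - G (M t (G v)) y) + d * (D v 1 * (x - y))
        + e * (D v 0 * (x - y)) := by
      rw [K_apply]; simp [X]; ring
    rw [key]
    have e1 : |-(a * (G v x - G v y))| ≤ |a| * (2 * |x - y|) := by
      rw [abs_neg, abs_mul]; gcongr
    have e2 : |b * (G (G v) x - G (G v) y)| ≤ |b| * (4 * |x - y|) := by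
      rw [abs_mul]; gcongr
    have e3 : |c * (G (M t (G v)) x - G (M t (G v)) y)| ≤ |c| * (4 * C * |x - y|) := by
      rw [abs_mul]; gcongr
    have e4 : |d * (D v 1 * (x - y))| ≤ |d| * (2 * |x - y|) := by
      rw [abs_mul, abs_mul]; gcongr
    have e5 : |e * (D v 0 * (x - y))| ≤ |e| * (2 * |x - y|) := by
      rw [abs_mul, abs_mul]; gcongr
    refine (abs_add_le _ _).trans ?_
    refine (add_le_add_left ((abs_add_le _ _).trans (add_le_add_left ((abs_add_le _ _).trans
      (add_le_add_left (abs_add_le _ _) _)) _)) _).trans ?_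
    linarith
  obtain ⟨L, hL, h⟩ := hsuff
  refine ⟨L + |d| * 2 + |e| * 2, by positivity, fun v hv => ⟨fun x hx y hy => (h v hv x hx y hy).trans ?_, fun x hx => ?_⟩⟩
  · gcongr
    have := mul_nonneg (abs_nonneg d) zero_le_two
    have := mul_nonneg (abs_nonneg e) zero_le_two
    linarith
  · have h5 : |D v 0| ≤ 2 := abs_le_of_sq_le_sq (by linarith [D_bound v 0 (by simp)]) (by norm_num)
    have h0 : |K a b c d e t v 0| ≤ |e| * 2 := by
      rw [K_apply]; simp only [ContinuousMap.sub_apply, ContinuousMap.add_apply,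
        ContinuousMap.smul_apply, G_zero]
      simp [X, abs_mul]; gcongr
    have h1 := h v hv x hx 0 (by simp)
    have h2 : |x - 0| ≤ 1 := by rw [sub_zero, abs_of_nonneg hx.1]; exact hx.2
    have h3 : L * |x - 0| ≤ L := by nlinarith
    have h4 := abs_add_le (K a b c d e t v x - K a b c d e t v 0) (K a b c d e t v 0)
    rw [sub_add_cancel] at h4
    have := mul_nonneg (abs_nonneg d) zero_le_two
    linarith

/-- Compactness -/
lemma compact_seq (L : ℝ) (f : ℕ → C(ℝ, ℝ))
    (h1 : ∀ n, ∀ x ∈ Icc (0:ℝ) 1, ∀ y ∈ Icc (0:ℝ) 1, |f n x - f n y| ≤ L * |x - y|)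
    (h2 : ∀ n, ∀ x ∈ Icc (0:ℝ) 1, |f n x| ≤ L) (hL : 0 ≤ L) :
    ∃ u : C(ℝ, ℝ), ∀ ε > 0, ∀ N : ℕ, ∃ n ≥ N, ∀ x ∈ Icc (0:ℝ) 1, |f n x - u x| ≤ ε := by
  let F : ℕ → BoundedContinuousFunction (Icc (0:ℝ) 1) ℝ := fun n =>
    BoundedContinuousFunction.mkOfCompact ((f n).restrict (Icc (0:ℝ) 1))
  have hF : ∀ n x, F n x = f n x := fun n x => rfl
  have hc : IsCompact (closure (range F)) := by
    apply BoundedContinuousFunction.arzela_ascoli (Icc (-L) L) isCompact_Icc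
    · rintro g x ⟨n, rfl⟩
      rw [hF]
      exact abs_le.1 (h2 n x x.2)
    · have : UniformEquicontinuous (fun (g : range F) => ((g : BoundedContinuousFunction (Icc (0:ℝ) 1) ℝ) : Icc (0:ℝ) 1 → ℝ)) := by
        apply LipschitzWith.uniformEquicontinuous _ (Real.toNNReal L)
        rintro ⟨g, n, rfl⟩
        apply LipschitzWith.of_dist_le_mul
        intro x y
        rw [Real.coe_toNNReal _ hL]
        exact h1 n x x.2 y y.2
      exact this.equicontinuous
  obtain ⟨g, -, φ, hφ, hlim⟩ := hc.tendsto_subseq (x := F) (fun n => subset_closure (mem_range_self n))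
  refine ⟨⟨IccExtend zero_le_one g, g.continuous.Icc_extend'⟩, ?_⟩
  intro ε hε N
  obtain ⟨k, hk⟩ := Metric.tendsto_atTop.1 hlim ε hε
  refine ⟨φ (max k N), (le_max_right k N).trans (hφ.id_le _), ?_⟩
  intro x hx
  have := (BoundedContinuousFunction.dist_coe_le_dist (⟨x, hx⟩ : Icc (0:ℝ) 1)).trans (hk (max k N) (le_max_left _ _)).le
  simp only [ContinuousMap.coe_mk, IccExtend_of_mem zero_le_one g hx]
  exact this

/-- kernel element from psd + degenerating sequence -/
lemma exists_kernel (m a b c d e C : ℝ) (hm : 0 < m) (ha : 0 ≤ a) (hb : 0 ≤ b) (hc : 0 ≤ c)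
    (hd : 0 ≤ d) (he : 0 ≤ e) (hC : 0 ≤ C) (t : C(ℝ, ℝ)) (ht : ∀ x ∈ Icc (0:ℝ) 1, |t x| ≤ C)
    (h0 : ∀ v, 0 ≤ ip (T m a b c d e t v) v)
    (hseq : ∀ ε > 0, ∃ v, ip v v = 1 ∧ ip (T m a b c d e t v) v ≤ ε) :
    ∃ v, ip v v ≠ 0 ∧ ∀ x ∈ Icc (0:ℝ) 1, T m a b c d e t v x = 0 := by
  set A := m + 4 * a + 4 * b + 4 * c * C + 4 * d + 4 * e with hA
  have hA0 : 0 < A := by positivity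
  have hup := T_upper m a b c d e C ha hb hc hd he hC t ht
  have hT := psd_bound (T m a b c d e t) (T_symm m a b c d e t) h0 A hA0 hup
  obtain ⟨L, hL, hK⟩ := K_lip a b c d e C hC t ht
  choose w hw1 hw2 using fun n : ℕ => hseq (1 / ((n : ℝ) + 1)) (by positivity)
  obtain ⟨u, hu⟩ := compact_seq L (fun n => K a b c d e t (w n)) (fun n => (hK _ (hw1 n).le).1)
    (fun n => (hK _ (hw1 n).le).2) hL
  set v : C(ℝ, ℝ) := -(m⁻¹ • u) with hv
  -- main approximation
  have happ : ∀ ε > 0, ∃ f, ip f f = 1 ∧ ip (T m a b c d e t f) (T m a b c d e t f) ≤ ε ∧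
      ip (f - v) (f - v) ≤ ε := by
    intro ε hε
    set δ := min ε (m ^ 2 * ε / 4) with hδ
    have hδ0 : 0 < δ := lt_min hε (by positivity)
    obtain ⟨N, hN⟩ := exists_nat_one_div_lt (show 0 < δ / A by positivity)
    obtain ⟨n, hn, hnu⟩ := hu (Real.sqrt δ) (Real.sqrt_pos.2 hδ0) N
    have hTn : ip (T m a b c d e t (w n)) (T m a b c d e t (w n)) ≤ δ := by
      refine (hT _).trans ?_
      have : ip (T m a b c d e t (w n)) (w n) ≤ δ / A := by
        refine (hw2 n).trans (le_trans ?_ hN.le)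
        apply one_div_le_one_div_of_le (by positivity)
        have : (N:ℝ) ≤ n := by exact_mod_cast hn
        linarith
      calc _ ≤ A * (δ / A) := by gcongr
        _ = δ := by field_simp
    refine ⟨w n, hw1 n, hTn.trans (min_le_left _ _), ?_⟩
    have hdec : w n - v = m⁻¹ • (T m a b c d e t (w n) + (u - K a b c d e t (w n))) := by
      rw [T_apply, hv]
      ext x
      simp
      field_simp
    have hKn : ip (u - K a b c d e t (w n)) (u - K a b c d e t (w n)) ≤ δ := by
      apply ip_le_of_bound
      intro x hx
      have := hnu x hx
      rw [ContinuousMap.sub_apply, ← sq_abs, abs_sub_comm]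
      calc _ ≤ Real.sqrt δ ^ 2 := by gcongr
        _ = δ := Real.sq_sqrt hδ0.le
    rw [hdec]
    have h4 := ip_add_le (T m a b c d e t (w n)) (u - K a b c d e t (w n))
    rw [map_smul, map_smul, LinearMap.smul_apply, smul_eq_mul, smul_eq_mul]
    have h5 : δ ≤ m ^ 2 * ε / 4 := min_le_right _ _
    calc _ ≤ m⁻¹ * (m⁻¹ * (m ^ 2 * ε)) := by gcongr; linarith
      _ = ε := by field_simp
  have hA2 : ∀ f, ip (T m a b c d e t f) (T m a b c d e t f) ≤ A ^ 2 * ip f f := by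
    intro f
    have := mul_le_mul_of_nonneg_left (hup f) hA0.le
    have := hT f
    nlinarith
  refine ⟨v, ?_, ?_⟩
  · intro hv0
    obtain ⟨f, hf1, -, hf2⟩ := happ (1/4) (by norm_num)
    have := ip_add_le (f - v) v
    rw [sub_add_cancel] at this
    linarith
  · apply eq_zero_of_ip
    apply le_antisymm _ (ip_self_nonneg _)
    apply le_of_forall_pos_le_add
    intro ε hε
    obtain ⟨f, hf1, hf2, hf3⟩ := happ (ε / (2 + 2 * A ^ 2)) (by positivity)
    have h6 := ip_add_le (T m a b c d e t f) (T m a b c d e t (v - f))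
    rw [← map_add, add_sub_cancel] at h6
    have h7 := hA2 (v - f)
    have h8 : ip (v - f) (v - f) = ip (f - v) (f - v) := by
      rw [← neg_sub f v]; simp only [map_neg, LinearMap.neg_apply, neg_neg]
    rw [h8] at h7
    have h9 := mul_le_mul_of_nonneg_left hf3 (sq_nonneg A)
    have : ε = 2 * (ε / (2 + 2 * A ^ 2)) + 2 * (A ^ 2 * (ε / (2 + 2 * A ^ 2))) := by field_simp
    linarith

end RT

namespace RT

lemma G_of_deriv (w w' v : C(ℝ, ℝ)) (h1 : ∀ x, HasDerivAt w (w' x) x)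
    (h2 : ∀ x, HasDerivAt w' (v x) x) (hw0 : w 0 = 0) (hw1 : w 1 = 0) : G v = w := by
  have hP : ∀ x, P v x = w' x - w' 0 := fun x => by
    rw [P_apply]
    exact intervalIntegral.integral_eq_sub_of_hasDerivAt (fun x _ => h2 x)
      (v.continuous.intervalIntegrable _ _)
  have hw : ∀ x, ∫ y in (0:ℝ)..x, w' y = w x := fun x => by
    rw [intervalIntegral.integral_eq_sub_of_hasDerivAt (fun x _ => h1 x)
      (w'.continuous.intervalIntegrable _ _), hw0, sub_zero]
  have hPP : P (P v) 1 = - w' 0 := by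
    rw [P_apply]
    simp only [hP]
    rw [intervalIntegral.integral_sub (w'.continuous.intervalIntegrable _ _) (by simp), hw, hw1]
    simp
  have hD : D v = w' := by
    ext x
    rw [D_apply, hP, hPP]; ring
  ext x
  rw [G_apply, hD, P_apply, hw]

lemma exists_test (t : C(ℝ, ℝ)) (x₀ : ℝ) (hx₀ : x₀ ∈ Ioo (0:ℝ) 1) (ht : t x₀ < 0) :
    ∃ v, ip (M t (G v)) (G v) < 0 := by
  have hev : ∀ᶠ x in nhds x₀, t x < 0 ∧ x ∈ Ioo (0:ℝ) 1 :=
    (t.continuous.continuousAt.eventually_lt continuousAt_const ht).and (isOpen_Ioo.mem_nhds hx₀)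
  obtain ⟨r, hr, hball⟩ := Metric.eventually_nhds_iff_ball.1 hev
  let f : ContDiffBump x₀ := ⟨r / 2, r, by positivity, by linarith⟩
  have hf : ContDiff ℝ (⊤ : ℕ∞) f := f.contDiff
  have hf1 : ContDiff ℝ (⊤ : ℕ∞) (deriv f) := hf.deriv' 
  have hf2 : ContDiff ℝ (⊤ : ℕ∞) (deriv (deriv f)) := hf1.deriv'
  have hout : ∀ x, ¬ (t x < 0 ∧ x ∈ Ioo (0:ℝ) 1) → f x = 0 := by
    intro x hx
    apply f.zero_of_le_dist
    by_contra hlt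
    exact hx (hball x (by simpa using hlt))
  have hG := G_of_deriv ⟨f, hf.continuous⟩ ⟨deriv f, hf1.continuous⟩ ⟨_, hf2.continuous⟩
    (fun x => (hf.differentiable (by simp) x).hasDerivAt)
    (fun x => (hf1.differentiable (by simp) x).hasDerivAt)
    (hout 0 (by simp)) (hout 1 (by simp))
  refine ⟨⟨_, hf2.continuous⟩, ?_⟩
  rw [hG, ip_apply, ← neg_pos, ← intervalIntegral.integral_neg]
  have hc : Continuous fun y => -(t y * f y * f y) := by
    have := hf.continuous
    have := t.continuous
    fun_prop
  refine intervalIntegral.integral_pos zero_lt_one hc.continuousOn ?_ ⟨x₀, Ioo_subset_Icc_self hx₀, ?_⟩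
  · intro x _
    show 0 ≤ -(t x * f x * f x)
    by_cases hx : t x < 0
    · nlinarith [mul_self_nonneg (f x)]
    · rw [hout x (fun h => hx h.1)]; simp
  · show 0 < -(t x₀ * f x₀ * f x₀)
    have : f x₀ = 1 := f.one_of_mem_closedBall (Metric.mem_closedBall_self f.rIn_pos.le)
    rw [this]; linarith

lemma exists_mode (μ k0 k1 c ξ : ℝ) (hμ : 0 < μ) (hc : 0 < c)
    (hk0 : k0 ≤ 0) (hk1 : k1 ≤ 0) (t : C(ℝ, ℝ)) (x₀ : ℝ) (hx₀ : x₀ ∈ Ioo (0:ℝ) 1)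
    (ht : t x₀ < 0) (hξ : ξ ≠ 0) :
    ∃ s : ℝ, 0 < s ∧ ∃ v, ip v v ≠ 0 ∧ ∀ x ∈ Icc (0:ℝ) 1,
      T (s * μ) (s ^ 2 + 2 * s * μ * ξ ^ 2) (s ^ 2 * ξ ^ 2 + s * μ * ξ ^ 4) c (-(s * k1))
        (-(s * k0)) t v x = 0 := by
  obtain ⟨C, hC⟩ := isCompact_Icc.exists_bound_of_continuousOn (s := Icc (0:ℝ) 1)
    t.continuous.continuousOn
  simp only [Real.norm_eq_abs] at hC
  have hC0 : 0 ≤ C := (abs_nonneg _).trans (hC 0 (by simp))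
  set TT : ℝ → (C(ℝ, ℝ) →ₗ[ℝ] C(ℝ, ℝ)) := fun s =>
    T (s * μ) (s ^ 2 + 2 * s * μ * ξ ^ 2) (s ^ 2 * ξ ^ 2 + s * μ * ξ ^ 4) c (-(s * k1))
        (-(s * k0)) t with hTT
  let q1 : C(ℝ, ℝ) → ℝ := fun v => ip (D v) (D v) + ξ ^ 2 * ip (G v) (G v)
  let q2 : C(ℝ, ℝ) → ℝ := fun v => μ * (ip v v + 2 * ξ ^ 2 * ip (D v) (D v)
    + ξ ^ 4 * ip (G v) (G v)) + (-k1) * (D v 1) ^ 2 + (-k0) * (D v 0) ^ 2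
  let q3 : C(ℝ, ℝ) → ℝ := fun v => c * ip (M t (G v)) (G v)
  have hq : ∀ s v, ip (TT s v) v = s ^ 2 * q1 v + s * q2 v + q3 v := by
    intro s v
    simp only [hTT, T_form, q1, q2, q3]
    ring
  have hk1' : 0 ≤ -k1 := by linarith
  have hk0' : 0 ≤ -k0 := by linarith
  have hq1 : ∀ v, 0 ≤ q1 v := fun v => by
    have := ip_self_nonneg (D v)
    have := ip_self_nonneg (G v)
    positivity
  have hq2' : ∀ v, μ * ξ ^ 4 * ip (G v) (G v) ≤ q2 v := fun v => by
    have h1 := ip_self_nonneg (D v)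
    have h2 := ip_self_nonneg v
    have : 0 ≤ μ * (ip v v + 2 * ξ ^ 2 * ip (D v) (D v)) + (-k1) * (D v 1) ^ 2
      + (-k0) * (D v 0) ^ 2 := by positivity
    simp only [q2]; linarith
  have hq2 : ∀ v, 0 ≤ q2 v := fun v => by
    have := ip_self_nonneg (G v)
    exact le_trans (by positivity) (hq2' v)
  have hq3 : ∀ v, |q3 v| ≤ c * (C * ip (G v) (G v)) := fun v => by
    simp only [q3, abs_mul, abs_of_pos hc]
    gcongr
    exact M_bound t C hC _
  have hb1 : ∀ v, q1 v ≤ (4 + 4 * ξ ^ 2) * ip v v := fun v => by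
    have h1 := D_ip_bound v
    have h2 := mul_le_mul_of_nonneg_left (G_ip_bound v) (sq_nonneg ξ)
    simp only [q1]; linarith
  set c2 := μ * (1 + 8 * ξ ^ 2 + 4 * ξ ^ 4) + (-k1) * 4 + (-k0) * 4 with hc2
  have hc20 : 0 ≤ c2 := by positivity
  have hb2 : ∀ v, q2 v ≤ c2 * ip v v := fun v => by
    have h1 := mul_le_mul_of_nonneg_left (D_ip_bound v) (show 0 ≤ μ * (2 * ξ ^ 2) by positivity)
    have h2 := mul_le_mul_of_nonneg_left (G_ip_bound v) (show 0 ≤ μ * ξ ^ 4 by positivity)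
    have h4 := mul_le_mul_of_nonneg_left (D_bound v 1 (by simp)) hk1'
    have h5 := mul_le_mul_of_nonneg_left (D_bound v 0 (by simp)) hk0'
    simp only [q2, hc2]; linarith
  let S : Set ℝ := {s | 0 < s ∧ ∃ v, ip (TT s v) v < 0}
  have hSne : ∃ s, s ∈ S := by
    obtain ⟨v, hv⟩ := exists_test t x₀ hx₀ ht
    have h3 : q3 v < 0 := mul_neg_of_pos_of_neg hc hv
    have hcont : Filter.Tendsto (fun s : ℝ => s ^ 2 * q1 v + s * q2 v + q3 v)
        (nhdsWithin 0 (Ioi 0)) (nhds (0 ^ 2 * q1 v + 0 * q2 v + q3 v)) :=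
      (Continuous.tendsto (by fun_prop) 0).mono_left nhdsWithin_le_nhds
    have hlt := hcont.eventually_lt_const (u := 0) (by simpa using h3)
    obtain ⟨s, hs1, hs2⟩ := (hlt.and self_mem_nhdsWithin).exists
    exact ⟨s, hs2, v, by rw [hq]; exact hs1⟩
  have hSb : BddAbove S := by
    refine ⟨c * C / (μ * ξ ^ 4), ?_⟩
    rintro s ⟨hs, v, hv⟩
    by_contra hlt
    push Not at hlt
    rw [div_lt_iff₀ (by positivity)] at hlt
    rw [hq] at hv
    have h1 := ip_self_nonneg (G v)
    have h2 := mul_le_mul_of_nonneg_left (hq2' v) hs.le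
    have h3 := neg_le_of_abs_le (hq3 v)
    have h4 := mul_le_mul_of_nonneg_right hlt.le h1
    have h5 := mul_nonneg (sq_nonneg s) (hq1 v)
    linarith
  obtain ⟨s0, hs0⟩ := hSne
  set s := sSup S with hs
  have hspos : 0 < s := hs0.1.trans_le (le_csSup hSb hs0)
  refine ⟨s, hspos, ?_⟩
  refine exists_kernel _ _ _ _ _ _ C (by positivity) (by positivity) (by positivity) hc.le
    (by nlinarith) (by nlinarith) hC0 t hC ?_ ?_
  · intro v
    have hcont : Filter.Tendsto (fun s : ℝ => ip (TT s v) v)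
        (nhdsWithin s (Ioi s)) (nhds (ip (TT s v) v)) := by
      simp only [hq]
      exact (Continuous.tendsto (by fun_prop) s).mono_left nhdsWithin_le_nhds
    refine ge_of_tendsto hcont ?_
    filter_upwards [self_mem_nhdsWithin] with r hr
    by_contra hlt
    push Not at hlt
    have : r ≤ s := le_csSup hSb ⟨hspos.trans hr, v, hlt⟩
    exact absurd hr (not_lt.2 this)
  · intro ε hε
    set B := 2 * s * (4 + 4 * ξ ^ 2) + c2 + 1 with hB
    have hB0 : 0 < B := by positivity
    obtain ⟨r, hrS, hr⟩ := exists_lt_of_lt_csSup ⟨s0, hs0⟩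
      (show s - ε / B < sSup S by have : 0 < ε / B := by positivity
                                  linarith)
    have hrs : r ≤ s := le_csSup hSb hrS
    obtain ⟨hr0, v, hv⟩ := hrS
    have hN : 0 < ip v v := by
      rcases (ip_self_nonneg v).lt_or_eq with h | h
      · exact h
      · exfalso
        have h1 : ip (G v) (G v) ≤ 0 := by have := G_ip_bound v; linarith
        have h3 := neg_le_of_abs_le (hq3 v)
        rw [hq] at hv
        have h4 := mul_nonneg (sq_nonneg r) (hq1 v)
        have h5 := mul_nonneg hr0.le (hq2 v)
        have h6 := mul_nonneg hc.le (mul_nonneg hC0 (neg_nonneg.2 h1))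
        linarith
    have hkey : ip (TT s v) v ≤ ε * ip v v := by
      rw [hq] at hv ⊢
      have h1 : (s ^ 2 - r ^ 2) * q1 v ≤ (s - r) * (2 * s) * ((4 + 4 * ξ ^ 2) * ip v v) := by
        apply mul_le_mul _ (hb1 v) (hq1 v) (mul_nonneg (by linarith) (by linarith))
        nlinarith
      have h2 : (s - r) * q2 v ≤ (s - r) * (c2 * ip v v) :=
        mul_le_mul_of_nonneg_left (hb2 v) (by linarith)
      have h3 : (s - r) * B ≤ ε := by
        rw [← le_div_iff₀ hB0]; linarith
      have h4 := mul_le_mul_of_nonneg_right h3 hN.le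
      have h5 : 0 ≤ (s - r) * ip v v := mul_nonneg (by linarith) hN.le
      rw [hB] at h4
      linarith
    refine ⟨(Real.sqrt (ip v v))⁻¹ • v, ?_, ?_⟩
    · simp only [map_smul, LinearMap.smul_apply, smul_eq_mul]
      have := Real.sqrt_pos.2 hN
      field_simp
      rw [Real.sq_sqrt hN.le]
    · change ip (TT s _) _ ≤ _
      simp only [map_smul, LinearMap.smul_apply, smul_eq_mul]
      have h1 := Real.sqrt_pos.2 hN
      rw [← mul_assoc, ← mul_inv, Real.mul_self_sqrt hN.le, inv_mul_le_iff₀ hN]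
      linarith

/-- first-order system on [0,1] -/
lemma exists_system (μ k0 k1 c ξ : ℝ) (hμ : 0 < μ) (hc : 0 < c)
    (hk0 : k0 ≤ 0) (hk1 : k1 ≤ 0) (t : C(ℝ, ℝ)) (x₀ : ℝ) (hx₀ : x₀ ∈ Ioo (0:ℝ) 1)
    (ht : t x₀ < 0) (hξ : ξ ≠ 0) :
    ∃ s : ℝ, 0 < s ∧ ∃ Y0 Y1 Y2 Y3 : ℝ → ℝ,
      (∃ x ∈ Icc (0:ℝ) 1, Y0 x ≠ 0) ∧ (∀ x ∈ Icc (0:ℝ) 1, HasDerivAt Y0 (Y1 x) x) ∧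
      (∀ x ∈ Icc (0:ℝ) 1, HasDerivAt Y1 (Y2 x) x) ∧
      (∀ x ∈ Icc (0:ℝ) 1, HasDerivAt Y2 (Y3 x) x) ∧
      (∀ x ∈ Icc (0:ℝ) 1, HasDerivAt Y3 ((s * μ)⁻¹ * ((s ^ 2 + 2 * s * μ * ξ ^ 2) * Y2 x
        - (s ^ 2 * ξ ^ 2 + s * μ * ξ ^ 4 + c * t x) * Y0 x)) x) ∧
      Y0 0 = 0 ∧ Y0 1 = 0 ∧ Y2 1 = k1 / μ * Y1 1 ∧ Y2 0 = -(k0 / μ) * Y1 0 := by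
  obtain ⟨s, hs, v, hv, hT⟩ := exists_mode μ k0 k1 c ξ hμ hc hk0 hk1 t x₀ hx₀ ht hξ
  set a := s ^ 2 + 2 * s * μ * ξ ^ 2 with ha
  set b := s ^ 2 * ξ ^ 2 + s * μ * ξ ^ 4 with hb
  have hm : 0 < s * μ := by positivity
  let Y2 : ℝ → ℝ := fun x => -(s * μ)⁻¹ * (-a * G v x + b * G (G v) x + c * G (M t (G v)) x +
    (-(s * k1)) * (D v 1 * x) - (-(s * k0)) * (D v 0 * (1 - x)))
  let Y3 : ℝ → ℝ := fun x => -(s * μ)⁻¹ * (-a * D v x + b * D (G v) x + c * D (M t (G v)) x +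
    (-(s * k1)) * (D v 1 * 1) - (-(s * k0)) * (D v 0 * (-1)))
  have hY2 : ∀ x ∈ Icc (0:ℝ) 1, v x = Y2 x := by
    intro x hx
    have := hT x hx
    rw [T_apply, K_apply] at this
    simp [X] at this
    simp only [Y2]
    field_simp
    linarith
  refine ⟨s, hs, G v, D v, Y2, Y3, ?_, fun x _ => G_deriv v x, fun x hx => ?_, fun x hx => ?_,
    fun x hx => ?_, G_zero v, G_one v, ?_, ?_⟩
  · by_contra hne
    push Not at hne
    have h1 : ∀ x ∈ Ioo (0:ℝ) 1, D v x = 0 := by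
      intro x hx
      have : (G v : ℝ → ℝ) =ᶠ[nhds x] fun _ => 0 := by
        filter_upwards [isOpen_Ioo.mem_nhds hx] with y hy
        exact hne y (Ioo_subset_Icc_self hy)
      exact (G_deriv v x).unique ((hasDerivAt_const x (0:ℝ)).congr_of_eventuallyEq this)
    have h2 : ∀ x ∈ Ioo (0:ℝ) 1, v x = 0 := by
      intro x hx
      have : (D v : ℝ → ℝ) =ᶠ[nhds x] fun _ => 0 := by
        filter_upwards [isOpen_Ioo.mem_nhds hx] with y hy
        exact h1 y hy
      exact (D_deriv v x).unique ((hasDerivAt_const x (0:ℝ)).congr_of_eventuallyEq this)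
    apply hv
    rw [ip_apply, intervalIntegral.integral_of_le zero_le_one, integral_Ioc_eq_integral_Ioo]
    rw [setIntegral_congr_fun (g := fun _ => (0:ℝ)) measurableSet_Ioo]
    · simp
    · intro x hx
      simp [h2 x hx]
  · rw [← hY2 x hx]; exact D_deriv v x
  · exact ((((((G_deriv v x).const_mul (-a)).add ((G_deriv (G v) x).const_mul b)).add
      ((G_deriv (M t (G v)) x).const_mul c)).add
      (((hasDerivAt_id x).const_mul (D v 1)).const_mul (-(s * k1)))).sub
      ((((hasDerivAt_id x).const_sub 1).const_mul (D v 0)).const_mul (-(s * k0)))).const_mul _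
  · have := ((((((D_deriv v x).const_mul (-a)).add ((D_deriv (G v) x).const_mul b)).add
      ((D_deriv (M t (G v)) x).const_mul c)).add_const ((-(s * k1)) * (D v 1 * 1))).sub_const
      ((-(s * k0)) * (D v 0 * (-1)))).const_mul (-(s * μ)⁻¹)
    have he : (s * μ)⁻¹ * (a * Y2 x - (b + c * t x) * G v x) =
        -(s * μ)⁻¹ * (-a * v x + b * G v x + c * M t (G v) x) := by
      rw [M_apply, hY2 x hx]
      ring
    rw [he]
    exact this
  · simp only [Y2, G_one]
    field_simp
    ring
  · simp only [Y2, G_zero]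
    field_simp
    ring

end RT

namespace RT

lemma hd_fst {E F : Type*} [NormedAddCommGroup E] [NormedSpace ℝ E] [NormedAddCommGroup F]
    [NormedSpace ℝ F] {z : ℝ → E × F} {a : E × F} {x : ℝ} (h : HasDerivAt z a x) :
    HasDerivAt (fun t => (z t).1) a.1 x :=
  (ContinuousLinearMap.fst ℝ E F).hasFDerivAt.comp_hasDerivAt x h

lemma hd_snd {E F : Type*} [NormedAddCommGroup E] [NormedSpace ℝ E] [NormedAddCommGroup F]
    [NormedSpace ℝ F] {z : ℝ → E × F} {a : E × F} {x : ℝ} (h : HasDerivAt z a x) :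
    HasDerivAt (fun t => (z t).2) a.2 x :=
  (ContinuousLinearMap.snd ℝ E F).hasFDerivAt.comp_hasDerivAt x h

lemma local_sol (α : ℝ) (p : ℝ → ℝ) (hp : ContDiff ℝ (⊤ : ℕ∞) p) (t₀ y0 y1 y2 y3 : ℝ) :
    ∃ Z0 Z1 Z2 Z3 : ℝ → ℝ, ∃ ε > 0, (Z0 t₀ = y0 ∧ Z1 t₀ = y1 ∧ Z2 t₀ = y2 ∧ Z3 t₀ = y3) ∧
      ∀ t ∈ Ioo (t₀ - ε) (t₀ + ε), HasDerivAt Z0 (Z1 t) t ∧ HasDerivAt Z1 (Z2 t) t ∧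
        HasDerivAt Z2 (Z3 t) t ∧ HasDerivAt Z3 (α * Z2 t + p t * Z0 t) t := by
  let f : ℝ × ℝ × ℝ × ℝ × ℝ → ℝ × ℝ × ℝ × ℝ × ℝ := fun z =>
    (1, z.2.2.1, z.2.2.2.1, z.2.2.2.2, α * z.2.2.2.1 + p z.1 * z.2.1)
  have hp1 : ContDiff ℝ 1 p := hp.of_le (by exact_mod_cast le_top)
  have hf : ContDiff ℝ 1 f := by
    have : ContDiff ℝ 1 (fun z : ℝ × ℝ × ℝ × ℝ × ℝ => p z.1) := hp1.comp contDiff_fst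
    fun_prop
  obtain ⟨z, hz0, ε, hε, hz⟩ :=
    (hf.contDiffAt (x := (t₀, y0, y1, y2, y3))).exists_forall_mem_closedBall_exists_eq_forall_mem_Ioo_hasDerivAt₀ t₀
  have ht : ∀ t ∈ Ioo (t₀ - ε) (t₀ + ε), (z t).1 = t := by
    intro t ht
    have := (convex_Ioo (t₀ - ε) (t₀ + ε)).norm_image_sub_le_of_norm_hasDerivWithin_le
      (f := fun t => (z t).1 - t) (f' := fun _ => 0) (C := 0)
      (fun x hx => by
        have h1 := (hd_fst (hz x hx)).sub (hasDerivAt_id x)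
        have h2 : (f (z x)).1 - 1 = 0 := by simp [f]
        rw [h2] at h1
        exact h1.hasDerivWithinAt) (fun x _ => by simp)
      (show t₀ ∈ Ioo (t₀ - ε) (t₀ + ε) by constructor <;> linarith) ht
    simp [hz0] at this
    linarith
  refine ⟨fun t => (z t).2.1, fun t => (z t).2.2.1, fun t => (z t).2.2.2.1,
    fun t => (z t).2.2.2.2, ε, hε, by simp [hz0], ?_⟩
  intro t htt
  have h := hz t htt
  refine ⟨hd_fst (hd_snd h), hd_fst (hd_snd (hd_snd h)), hd_fst (hd_snd (hd_snd (hd_snd h))), ?_⟩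
  have h4 := hd_snd (hd_snd (hd_snd (hd_snd h)))
  have he : (f (z t)).2.2.2.2 = α * (z t).2.2.2.1 + p t * (z t).2.1 := by
    simp [f, ht t htt]
  rw [he] at h4
  exact h4

/-- gluing -/
def gl (c : ℝ) (f g : ℝ → ℝ) (x : ℝ) : ℝ := if x ≤ c then f x else g x

lemma gl_lin (α : ℝ) (p : ℝ → ℝ) (c : ℝ) (f g f' g' : ℝ → ℝ) (x : ℝ) :
    α * gl c f g x + p x * gl c f' g' x =
      gl c (fun x => α * f x + p x * f' x) (fun x => α * g x + p x * g' x) x := by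
  unfold gl
  split_ifs <;> rfl

lemma gl_deriv (c : ℝ) (f g f' g' : ℝ → ℝ) (x : ℝ) (h0 : f c = g c) (h1 : f' c = g' c)
    (hf : x ≤ c → HasDerivAt f (f' x) x) (hg : c ≤ x → HasDerivAt g (g' x) x) :
    HasDerivAt (gl c f g) (gl c f' g' x) x := by
  rcases lt_trichotomy x c with h | h | h
  · have : gl c f g =ᶠ[nhds x] f := by
      filter_upwards [gt_mem_nhds h] with y hy
      simp [gl, le_of_lt hy]
    rw [show gl c f' g' x = f' x by simp [gl, h.le]]
    exact (hf h.le).congr_of_eventuallyEq this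
  · subst h
    rw [show gl x f' g' x = f' x by simp [gl]]
    rw [← hasDerivWithinAt_univ, ← Iic_union_Ici (a := x)]
    apply HasDerivWithinAt.union
    · exact (hf le_rfl).hasDerivWithinAt.congr (fun y hy => by simp [gl, mem_Iic.1 hy]) (by simp [gl])
    · rw [h1]
      refine (hg le_rfl).hasDerivWithinAt.congr (fun y hy => ?_) (by simp [gl, h0])
      rcases (mem_Ici.1 hy).eq_or_lt with hxy | hxy
      · subst hxy; simp [gl, h0]
      · simp [gl, not_le.2 hxy]
  · have : gl c f g =ᶠ[nhds x] g := by
      filter_upwards [lt_mem_nhds h] with y hy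
      simp [gl, not_le.2 hy]
    rw [show gl c f' g' x = g' x by simp [gl, not_le.2 h]]
    exact (hg h.le).congr_of_eventuallyEq this

lemma extend_sol (α : ℝ) (p : ℝ → ℝ) (hp : ContDiff ℝ (⊤ : ℕ∞) p) (Y0 Y1 Y2 Y3 : ℝ → ℝ)
    (h0 : ∀ x ∈ Icc (0:ℝ) 1, HasDerivAt Y0 (Y1 x) x)
    (h1 : ∀ x ∈ Icc (0:ℝ) 1, HasDerivAt Y1 (Y2 x) x)
    (h2 : ∀ x ∈ Icc (0:ℝ) 1, HasDerivAt Y2 (Y3 x) x)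
    (h3 : ∀ x ∈ Icc (0:ℝ) 1, HasDerivAt Y3 (α * Y2 x + p x * Y0 x) x) :
    ∃ Z0 Z1 Z2 Z3 : ℝ → ℝ, ∃ ε > 0,
      (∀ x ∈ Icc (0:ℝ) 1, Z0 x = Y0 x ∧ Z1 x = Y1 x ∧ Z2 x = Y2 x ∧ Z3 x = Y3 x) ∧
      ∀ t ∈ Ioo (-ε) (1 + ε), HasDerivAt Z0 (Z1 t) t ∧ HasDerivAt Z1 (Z2 t) t ∧
        HasDerivAt Z2 (Z3 t) t ∧ HasDerivAt Z3 (α * Z2 t + p t * Z0 t) t := by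
  obtain ⟨R0, R1, R2, R3, ε, hε, ⟨r0, r1, r2, r3⟩, hR⟩ := local_sol α p hp 1 (Y0 1) (Y1 1) (Y2 1) (Y3 1)
  obtain ⟨L0, L1, L2, L3, δ, hδ, ⟨l0, l1, l2, l3⟩, hL⟩ := local_sol α p hp 0 (Y0 0) (Y1 0) (Y2 0) (Y3 0)
  have hA : ∀ x, 0 ≤ x → x < 1 + ε → HasDerivAt (gl 1 Y0 R0) (gl 1 Y1 R1 x) x ∧
      HasDerivAt (gl 1 Y1 R1) (gl 1 Y2 R2 x) x ∧ HasDerivAt (gl 1 Y2 R2) (gl 1 Y3 R3 x) x ∧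
      HasDerivAt (gl 1 Y3 R3) (α * gl 1 Y2 R2 x + p x * gl 1 Y0 R0 x) x := by
    intro x hx0 hx1
    refine ⟨gl_deriv _ _ _ _ _ _ r0.symm r1.symm (fun h => h0 x ⟨hx0, h⟩)
        (fun h => (hR x ⟨by linarith, hx1⟩).1),
      gl_deriv _ _ _ _ _ _ r1.symm r2.symm (fun h => h1 x ⟨hx0, h⟩)
        (fun h => (hR x ⟨by linarith, hx1⟩).2.1),
      gl_deriv _ _ _ _ _ _ r2.symm r3.symm (fun h => h2 x ⟨hx0, h⟩)
        (fun h => (hR x ⟨by linarith, hx1⟩).2.2.1), ?_⟩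
    have := gl_deriv 1 Y3 R3 (fun x => α * Y2 x + p x * Y0 x) (fun x => α * R2 x + p x * R0 x) x
      r3.symm (by simp only [r2, r0]) (fun h => h3 x ⟨hx0, h⟩)
        (fun h => (hR x ⟨by linarith, hx1⟩).2.2.2)
    rwa [gl_lin]
  have e : ∀ f g : ℝ → ℝ, gl 1 f g 0 = f 0 := fun f g => by simp [gl]
  refine ⟨gl 0 L0 (gl 1 Y0 R0), gl 0 L1 (gl 1 Y1 R1), gl 0 L2 (gl 1 Y2 R2), gl 0 L3 (gl 1 Y3 R3),
    min ε δ, lt_min hε hδ, ?_, ?_⟩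
  · intro x hx
    have : ∀ f g k : ℝ → ℝ, f 0 = g 0 → gl 0 f (gl 1 g k) x = g x := by
      intro f g k h
      rcases hx.1.eq_or_lt with h' | h'
      · subst h'; simp [gl, h]
      · simp [gl, not_le.2 h', hx.2]
    exact ⟨this _ _ _ l0, this _ _ _ l1, this _ _ _ l2, this _ _ _ l3⟩
  · intro x hx
    have hx1 : x < 1 + ε := by linarith [hx.2, min_le_left ε δ]
    have hx0 : 0 - δ < x := by linarith [hx.1, min_le_right ε δ]
    refine ⟨gl_deriv _ _ _ _ _ _ (by rw [e, l0]) (by rw [e, l1])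
        (fun h => (hL x ⟨hx0, by linarith⟩).1) (fun h => (hA x h hx1).1),
      gl_deriv _ _ _ _ _ _ (by rw [e, l1]) (by rw [e, l2])
        (fun h => (hL x ⟨hx0, by linarith⟩).2.1) (fun h => (hA x h hx1).2.1),
      gl_deriv _ _ _ _ _ _ (by rw [e, l2]) (by rw [e, l3])
        (fun h => (hL x ⟨hx0, by linarith⟩).2.2.1) (fun h => (hA x h hx1).2.2.1), ?_⟩
    have := gl_deriv 0 L3 (gl 1 Y3 R3) (fun x => α * L2 x + p x * L0 x)
      (fun x => α * gl 1 Y2 R2 x + p x * gl 1 Y0 R0 x) x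
      (by rw [e, l3]) (by simp only [e, l2, l0]) (fun h => (hL x ⟨hx0, by linarith⟩).2.2.2)
        (fun h => (hA x h hx1).2.2.2)
    rwa [gl_lin]

lemma deriv_on (J : Set ℝ) (hJ : IsOpen J) (w f f' : ℝ → ℝ) (h : ∀ x ∈ J, w x = f x)
    (hf : ∀ x ∈ J, HasDerivAt f (f' x) x) (x : ℝ) (hx : x ∈ J) : deriv w x = f' x := by
  have : w =ᶠ[nhds x] f := by
    filter_upwards [hJ.mem_nhds hx] with y hy using h y hy
  rw [this.deriv_eq, (hf x hx).deriv]

lemma smooth_succ (I : Set ℝ) (hI : IsOpen I) (f f' : ℝ → ℝ) (n : ℕ)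
    (hf : ∀ x ∈ I, HasDerivAt f (f' x) x) (h : ContDiffOn ℝ n f' I) :
    ContDiffOn ℝ (n + 1 : ℕ) f I := by
  push_cast
  rw [contDiffOn_succ_iff_deriv_of_isOpen hI]
  refine ⟨fun x hx => (hf x hx).differentiableAt.differentiableWithinAt, by simp, ?_⟩
  exact h.congr (fun x hx => (hf x hx).deriv)

lemma smooth_ext (α : ℝ) (p : ℝ → ℝ) (hp : ContDiff ℝ (⊤ : ℕ∞) p) (Y0 Y1 Y2 Y3 : ℝ → ℝ)
    (h0 : ∀ x ∈ Icc (0:ℝ) 1, HasDerivAt Y0 (Y1 x) x)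
    (h1 : ∀ x ∈ Icc (0:ℝ) 1, HasDerivAt Y1 (Y2 x) x)
    (h2 : ∀ x ∈ Icc (0:ℝ) 1, HasDerivAt Y2 (Y3 x) x)
    (h3 : ∀ x ∈ Icc (0:ℝ) 1, HasDerivAt Y3 (α * Y2 x + p x * Y0 x) x) :
    ∃ W : ℝ → ℝ, ContDiff ℝ (⊤ : ℕ∞) W ∧ ∀ x ∈ Icc (0:ℝ) 1, W x = Y0 x ∧ deriv W x = Y1 x ∧
      deriv (deriv W) x = Y2 x ∧ deriv (deriv (deriv (deriv W))) x = α * Y2 x + p x * Y0 x := by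
  obtain ⟨Z0, Z1, Z2, Z3, ε, hε, hZY, hZ⟩ := extend_sol α p hp Y0 Y1 Y2 Y3 h0 h1 h2 h3
  set I := Ioo (-ε) (1 + ε) with hI
  have hIo : IsOpen I := isOpen_Ioo
  have hsm : ∀ n : ℕ, ContDiffOn ℝ n Z0 I ∧ ContDiffOn ℝ n Z1 I ∧ ContDiffOn ℝ n Z2 I ∧
      ContDiffOn ℝ n Z3 I := by
    intro n
    induction n with
    | zero =>
      simp only [Nat.cast_zero, contDiffOn_zero]
      exact ⟨fun x hx => (hZ x hx).1.continuousAt.continuousWithinAt,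
        fun x hx => (hZ x hx).2.1.continuousAt.continuousWithinAt,
        fun x hx => (hZ x hx).2.2.1.continuousAt.continuousWithinAt,
        fun x hx => (hZ x hx).2.2.2.continuousAt.continuousWithinAt⟩
    | succ n ih =>
      obtain ⟨i0, i1, i2, i3⟩ := ih
      refine ⟨smooth_succ I hIo _ _ n (fun x hx => (hZ x hx).1) i1,
        smooth_succ I hIo _ _ n (fun x hx => (hZ x hx).2.1) i2,
        smooth_succ I hIo _ _ n (fun x hx => (hZ x hx).2.2.1) i3,
        smooth_succ I hIo _ _ n (fun x hx => (hZ x hx).2.2.2) ?_⟩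
      have hpn : ContDiffOn ℝ n p I := (hp.of_le (by exact_mod_cast le_top)).contDiffOn
      exact (contDiffOn_const.mul i2).add (hpn.mul i0)
  have hsm0 : ContDiffOn ℝ (⊤ : ℕ∞) Z0 I := contDiffOn_infty.2 fun n => (hsm n).1
  let χ : ContDiffBump (1/2 : ℝ) := ⟨1/2 + ε/4, 1/2 + ε/2, by positivity, by linarith⟩
  refine ⟨fun x => χ x * Z0 x, ?_, ?_⟩
  · rw [contDiff_iff_contDiffAt]
    intro x
    by_cases hx : x ∈ I
    · exact χ.contDiff.contDiffAt.mul (hsm0.contDiffAt (hIo.mem_nhds hx))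
    · have hx' : x ∈ (Metric.closedBall (1/2 : ℝ) (1/2 + ε/2))ᶜ := by
        intro hmem
        apply hx
        rw [Real.closedBall_eq_Icc] at hmem
        exact ⟨by linarith [hmem.1], by linarith [hmem.2]⟩
      have : (fun x => χ x * Z0 x) =ᶠ[nhds x] fun _ => 0 := by
        filter_upwards [Metric.isClosed_closedBall.isOpen_compl.mem_nhds hx'] with y hy
        have : χ y = 0 := χ.zero_of_le_dist (by
          simp only [mem_compl_iff, Metric.mem_closedBall, not_le] at hy
          exact hy.le)
        rw [this, zero_mul]
      exact contDiffAt_const.congr_of_eventuallyEq this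
  · set J := Ioo (-(ε/4)) (1 + ε/4) with hJ
    have hJo : IsOpen J := isOpen_Ioo
    have hJI : ∀ x ∈ J, x ∈ I := fun x hx => ⟨by linarith [hx.1], by linarith [hx.2]⟩
    have d0 : ∀ x ∈ J, (fun x => χ x * Z0 x) x = Z0 x := by
      intro x hx
      have : χ x = 1 := χ.one_of_mem_closedBall (by
        rw [Real.closedBall_eq_Icc]
        exact ⟨by simp only [χ]; linarith [hx.1], by simp only [χ]; linarith [hx.2]⟩)
      simp [this]
    have d1 := deriv_on J hJo _ _ _ d0 (fun x hx => (hZ x (hJI x hx)).1)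
    have d2 := deriv_on J hJo _ _ _ d1 (fun x hx => (hZ x (hJI x hx)).2.1)
    have d3 := deriv_on J hJo _ _ _ d2 (fun x hx => (hZ x (hJI x hx)).2.2.1)
    have d4 := deriv_on J hJo _ _ (fun x => α * Z2 x + p x * Z0 x) d3
      (fun x hx => (hZ x (hJI x hx)).2.2.2)
    intro x hx
    have hxJ : x ∈ J := ⟨by linarith [hx.1], by linarith [hx.2]⟩
    obtain ⟨z0, z1, z2, z3⟩ := hZY x hx
    refine ⟨(d0 x hxJ).trans z0, (d1 x hxJ).trans z1, (d2 x hxJ).trans z2, (d4 x hxJ).trans ?_⟩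
    simp only [z2, z0]

end RT

/-- Existence of a growing normal mode for the linearized Rayleigh–Taylor problem. -/
theorem growing_normal_mode (μ g k0 k1 : ℝ) (hμ : 0 < μ) (hg : 0 < g)
    (hk0 : k0 ≤ 0) (hk1 : k1 ≤ 0) (θb : ℝ → ℝ) (hθb : ContDiff ℝ (⊤ : ℕ∞) θb)
    (hRT : ∃ x₀ ∈ Ioo (0 : ℝ) 1, deriv θb x₀ < 0)
    (ξ : ℝ) (hξ : ξ ≠ 0) :
    ∃ lam : ℝ, ∃ W : ℝ → ℝ, 0 < lam ∧ ContDiff ℝ (⊤ : ℕ∞) W ∧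
      (∃ x ∈ Icc (0 : ℝ) 1, W x ≠ 0) ∧
      (∀ x ∈ Icc (0 : ℝ) 1,
        -lam ^ 2 * (deriv (deriv W) x - ξ ^ 2 * W x) =
          -(lam * μ) * (deriv (deriv (deriv (deriv W))) x
              - 2 * ξ ^ 2 * deriv (deriv W) x + ξ ^ 4 * W x)
            - g * ξ ^ 2 * deriv θb x * W x) ∧
      W 0 = 0 ∧ W 1 = 0 ∧
      deriv (deriv W) 1 = (k1 / μ) * deriv W 1 ∧
      deriv (deriv W) 0 = -(k0 / μ) * deriv W 0 := by
  obtain ⟨x₀, hx₀, hneg⟩ := hRT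
  have hθ' : ContDiff ℝ (⊤ : ℕ∞) (deriv θb) := hθb.deriv'
  obtain ⟨s, hs, Y0, Y1, Y2, Y3, hne, h0, h1, h2, h3, b0, b1, b2, b3⟩ :=
    RT.exists_system μ k0 k1 (g * ξ ^ 2) ξ hμ (by positivity) hk0 hk1 ⟨deriv θb, hθ'.continuous⟩
      x₀ hx₀ hneg hξ
  obtain ⟨W, hW, hWY⟩ := RT.smooth_ext ((s * μ)⁻¹ * (s ^ 2 + 2 * s * μ * ξ ^ 2))
    (fun x => -(s * μ)⁻¹ * (s ^ 2 * ξ ^ 2 + s * μ * ξ ^ 4 + g * ξ ^ 2 * deriv θb x))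
    (contDiff_const.mul (contDiff_const.add (contDiff_const.mul hθ'))) Y0 Y1 Y2 Y3 h0 h1 h2
    (fun x hx => by
      have := h3 x hx
      simp only [ContinuousMap.coe_mk] at this
      convert this using 1
      ring)
  have i0 : (0:ℝ) ∈ Icc (0:ℝ) 1 := by simp
  have i1 : (1:ℝ) ∈ Icc (0:ℝ) 1 := by simp
  refine ⟨s, W, hs, hW, ?_, ?_, ?_, ?_, ?_, ?_⟩
  · obtain ⟨x, hx, hxne⟩ := hne
    exact ⟨x, hx, by rwa [(hWY x hx).1]⟩
  · intro x hx
    obtain ⟨w0, w1, w2, w4⟩ := hWY x hx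
    rw [w0, w2, w4]
    field_simp
    ring
  · rw [(hWY 0 i0).1, b0]
  · rw [(hWY 1 i1).1, b1]
  · rw [(hWY 1 i1).2.2.1, (hWY 1 i1).2.1, b2]
  · rw [(hWY 0 i0).2.2.1, (hWY 0 i0).2.1, b3]
end
end
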